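/- arXiv:2009.04529 — 4 statements merged into one kernel-verified Lean document; each statement's English description precedes it below -/
import Mathlib

section
/- Let G be a graph on n vertices and let k be an integer with 0 ≤ k ≤ n. If the clique partition number satisfies cp(G) ≥ n−k, then G has at most C(n,2) − C(n−k,2) edges. Moreover, if cp(G) = n−k and G has exactly C(n,2) − C(n−k,2) edges, then G is isomorphic to K_k ⊕ E_{n−k}. -/
open SimpleGraph

/-- A strategy for the guessing game on `G` with `s` colors: a family of guessing
functions, one per vertex, where each vertex's guess depends only on the colors
of the vertices in its (open) neighborhood. -/
def IsGuessingStrategy {V : Type*} (G : SimpleGraph V) (s : ℕ)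
    (f : V → (V → Fin s) → Fin s) : Prop :=
  ∀ (v : V) (c₁ c₂ : V → Fin s), (∀ u, G.Adj v u → c₁ u = c₂ u) → f v c₁ = f v c₂

/-- The maximum, over all strategies for the guessing game on `G` with `s` colors,
of the number of fixed points of the strategy (colorings where every vertex
guesses its own color correctly). -/
noncomputable def maxFixedPoints {V : Type*} (G : SimpleGraph V) (s : ℕ) : ℕ :=
  sSup {n : ℕ | ∃ f : V → (V → Fin s) → Fin s, IsGuessingStrategy G s f ∧
    n = Nat.card {c : V → Fin s // ∀ v, f v c = c v}}

/-- The guessing number of `G` with `s` colors: the logarithm base `s` of the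
maximum number of fixed points of a strategy. -/
noncomputable def guessingNumber {V : Type*} (G : SimpleGraph V) (s : ℕ) : ℝ :=
  Real.logb s (maxFixedPoints G s)

/-- The join `K_k ⊕ E_{n-k}`: the first `k` vertices form a clique and are joined
to all other vertices; the remaining `n - k` vertices form an independent set. -/
def cliqueJoinEmpty (n k : ℕ) : SimpleGraph (Fin n) :=
  SimpleGraph.fromRel (fun u _ => (u : ℕ) < k)

/-- The extremal number `ex(n, gn_s ≥ a)`: the maximum number of edges over all
graphs on `n` vertices whose guessing number with `s` colors is `< a`. -/
noncomputable def exGN (n s : ℕ) (a : ℝ) : ℕ :=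
  sSup {m : ℕ | ∃ G : SimpleGraph (Fin n),
    guessingNumber G s < a ∧ m = Nat.card G.edgeSet}

/-- `G` is `(gn_s ≥ a)`-saturated: `gn(G,s) < a` but adding any missing edge
raises the guessing number to at least `a`. -/
def GNSaturated {V : Type*} (G : SimpleGraph V) (s : ℕ) (a : ℝ) : Prop :=
  guessingNumber G s < a ∧
    ∀ u w : V, u ≠ w → ¬G.Adj u w →
      a ≤ guessingNumber (G ⊔ SimpleGraph.fromEdgeSet {s(u, w)}) s

/-- The saturation number `sat(n, gn_s ≥ a)`: the minimum number of edges over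
all `(gn_s ≥ a)`-saturated graphs on `n` vertices. -/
noncomputable def satGN (n s : ℕ) (a : ℝ) : ℕ :=
  sInf {m : ℕ | ∃ G : SimpleGraph (Fin n),
    GNSaturated G s a ∧ m = Nat.card G.edgeSet}

/-- The disjoint union `H + E_{n-h}` of a graph `H` on `h` vertices with `n - h`
isolated vertices, realized on `Fin n`. -/
def withIsolated {h : ℕ} (H : SimpleGraph (Fin h)) (n : ℕ) : SimpleGraph (Fin n) :=
  SimpleGraph.fromRel (fun u v =>
    ∃ (hu : (u : ℕ) < h) (hv : (v : ℕ) < h), H.Adj ⟨u, hu⟩ ⟨v, hv⟩)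

/-- `K*_{a,a}`: the complete bipartite graph `K_{a,a}` with one subdivided edge.
Vertices `0, …, a-1` are `x_1, …, x_a`; vertices `a, …, 2a-1` are `y_1, …, y_a`;
vertex `2a` is the subdivision vertex `v_0`, adjacent exactly to `x_1` and `y_1`.
The edge `x_1 y_1` is removed. -/
def Kstar (a : ℕ) : SimpleGraph (Fin (2 * a + 1)) :=
  SimpleGraph.fromRel (fun u v =>
    ((u : ℕ) < a ∧ a ≤ (v : ℕ) ∧ (v : ℕ) < 2 * a ∧ ¬((u : ℕ) = 0 ∧ (v : ℕ) = a)) ∨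
    ((u : ℕ) = 2 * a ∧ ((v : ℕ) = 0 ∨ (v : ℕ) = a)))

/-- Add `b` dominating vertices to a graph `H` on `m` vertices: the first `b`
vertices are adjacent to everything else (and each other), the remaining `m`
vertices induce a copy of `H`. -/
def withDominating {m : ℕ} (H : SimpleGraph (Fin m)) (b : ℕ) :
    SimpleGraph (Fin (b + m)) :=
  SimpleGraph.fromRel (fun u v =>
    (u : ℕ) < b ∨ (v : ℕ) < b ∨
      ∃ (hu : b ≤ (u : ℕ)) (hv : b ≤ (v : ℕ)),
        H.Adj ⟨(u : ℕ) - b, by have := u.isLt; omega⟩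
          ⟨(v : ℕ) - b, by have := v.isLt; omega⟩)

/-- `F` is a minimal graph with `gn_s ≥ a`: its guessing number with `s` colors
is at least `a`, but every proper subgraph has guessing number `< a`. -/
def MinimalGN {V : Type*} [Finite V] (F : SimpleGraph V) (s : ℕ) (a : ℝ) : Prop :=
  a ≤ guessingNumber F s ∧
    ∀ H : F.Subgraph, H ≠ ⊤ → guessingNumber H.coe s < a

namespace SimpleGraph

variable {V : Type*}

/-- In a colouring with at most `χ(H)` colours, any two colour classes are joined by an edge. -/
theorem Coloring.exists_adj_of_le_chromaticNumber {H : SimpleGraph V} {m : ℕ}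
    (hm : (m : ℕ∞) ≤ H.chromaticNumber) (C : H.Coloring (Fin m)) {i j : Fin m} (hij : i ≠ j) :
    ∃ u v, H.Adj u v ∧ C u = i ∧ C v = j := by
  by_contra! h
  let C' : H.Coloring (Fin m) := Coloring.mk (fun v => if C v = j then i else C v) (by
    intro u v huv
    have h1 := C.valid huv
    have h2 := h u v huv
    have h3 := h v u huv.symm
    grind)
  obtain ⟨v, hv⟩ := le_chromaticNumber_iff_forall_surjective.1 hm C' j
  change (if C v = j then i else C v) = j at hv
  grind

/-- The map on edges induced by a colouring with at most `χ(H)` colours is surjective. -/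
theorem Coloring.mapEdgeSet_surjective {H : SimpleGraph V} {m : ℕ}
    (hm : (m : ℕ∞) ≤ H.chromaticNumber) (C : H.Coloring (Fin m)) :
    Function.Surjective (Hom.mapEdgeSet C) := by
  rintro ⟨e, he⟩
  induction e with
  | _ i j =>
    obtain ⟨u, v, huv, rfl, rfl⟩ :=
      C.exists_adj_of_le_chromaticNumber hm ((top_adj i j).1 he)
    exact ⟨⟨s(u, v), huv⟩, rfl⟩

theorem natCard_edgeSet_top [Finite V] :
    Nat.card (⊤ : SimpleGraph V).edgeSet = (Nat.card V).choose 2 := by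
  classical
  have := Fintype.ofFinite V
  rw [Nat.card_eq_fintype_card, Nat.card_eq_fintype_card, ← edgeFinset_card,
    card_edgeFinset_top_eq_card_choose_two]

theorem natCard_edgeSet_add_natCard_edgeSet_compl [Finite V] (G : SimpleGraph V) :
    Nat.card G.edgeSet + Nat.card Gᶜ.edgeSet = (Nat.card V).choose 2 := by
  rw [← natCard_edgeSet_top, ← sup_compl_eq_top (x := G), edgeSet_sup]
  simp only [Nat.card_coe_set_eq]
  exact (Set.ncard_union_eq (disjoint_edgeSet.2 disjoint_compl_right)).symm

theorem Coloring.choose_two_le_natCard_edgeSet [Finite V] {H : SimpleGraph V} {m : ℕ}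
    (hm : (m : ℕ∞) ≤ H.chromaticNumber) (C : H.Coloring (Fin m)) :
    m.choose 2 ≤ Nat.card H.edgeSet := by
  have h := Nat.card_le_card_of_surjective _ (C.mapEdgeSet_surjective hm)
  rwa [natCard_edgeSet_top, Nat.card_fin] at h

/-- A graph with chromatic number at least `m` has at least `m.choose 2` edges. -/
theorem choose_two_le_natCard_edgeSet [Finite V] {H : SimpleGraph V} {m : ℕ}
    (hm : (m : ℕ∞) ≤ H.chromaticNumber) : m.choose 2 ≤ Nat.card H.edgeSet := by
  have := Fintype.ofFinite V
  obtain ⟨C⟩ := colorable_chromaticNumber H.selfColoring.colorable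
  have hχ : ((ENat.toNat H.chromaticNumber : ℕ) : ℕ∞) = H.chromaticNumber :=
    ENat.natCast_toNat (chromaticNumber_ne_top_iff_exists.2 ⟨_, H.selfColoring.colorable⟩)
  refine le_trans (Nat.choose_le_choose 2 ?_) (C.choose_two_le_natCard_edgeSet hχ.le)
  rwa [← hχ, Nat.cast_le] at hm

/-- In an optimal colouring of a graph with exactly `m.choose 2` edges, two distinct vertices of
the same colour cannot both have neighbours. -/
theorem Coloring.eq_of_adj_of_adj [Finite V] {H : SimpleGraph V} {m : ℕ}
    (hm : (m : ℕ∞) ≤ H.chromaticNumber) (hcard : Nat.card H.edgeSet = m.choose 2)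
    (C : H.Coloring (Fin m)) {u v x y : V} (hux : H.Adj u x) (hvy : H.Adj v y)
    (huv : C u = C v) : u = v := by
  classical
  have hinj : Function.Injective (Hom.mapEdgeSet C) :=
    ((Nat.bijective_iff_surjective_and_card _).2 ⟨C.mapEdgeSet_surjective hm, by
      rw [natCard_edgeSet_top, Nat.card_fin, hcard]⟩).1
  have huniq : ∀ {a b c d : V}, H.Adj a b → H.Adj c d → C a = C c → C b = C d →
      a = c ∧ b = d := by
    intro a b c d hab hcd hac hbd
    have h := @hinj ⟨s(a, b), hab⟩ ⟨s(c, d), hcd⟩ (Subtype.ext (by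
      change s(C a, C b) = s(C c, C d)
      rw [hac, hbd]))
    have h' : s(a, b) = s(c, d) := congrArg Subtype.val h
    rcases Sym2.eq_iff.1 h' with h' | ⟨rfl, rfl⟩
    · exact h'
    · exact absurd hac (C.valid hab)
  by_contra hne
  let C' : H.Coloring (Fin m) := Coloring.mk (fun w => if w = u then C y else C w) (by
    intro a b hab
    have hval := C.valid hab
    have key : ∀ {w}, H.Adj u w → C w ≠ C y := fun hw hwy =>
      hne (huniq hw hvy huv hwy).1
    by_cases ha : a = u
    · subst ha
      simpa [hab.ne'] using (key hab).symm
    · by_cases hb : b = u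
      · subst hb
        simpa [ha] using key hab.symm
      · simpa [ha, hb] using hval)
  obtain ⟨a, b, hab, ha, hb⟩ :=
    C'.exists_adj_of_le_chromaticNumber hm (C.valid hux)
  change (if a = u then C y else C a) = C u at ha
  change (if b = u then C y else C b) = C x at hb
  have hau : a ≠ u := by
    rintro rfl
    rw [if_pos rfl, huv] at ha
    exact C.valid hvy ha.symm
  rw [if_neg hau] at ha
  by_cases hbu : b = u
  · subst hbu
    exact C.valid hab ha
  · rw [if_neg hbu] at hb
    exact hau (huniq hab hux ha hb).1

/-- A graph with chromatic number `m` and exactly `m.choose 2` edges is a complete graph on `m`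
vertices together with isolated vertices. -/
theorem exists_adj_iff_of_chromaticNumber_eq [Finite V] {H : SimpleGraph V} {m : ℕ}
    (hm : H.chromaticNumber = m) (hcard : Nat.card H.edgeSet = m.choose 2) :
    ∃ T : Set V, Nat.card T = m ∧ ∀ u v, H.Adj u v ↔ u ≠ v ∧ u ∈ T ∧ v ∈ T := by
  obtain ⟨C⟩ : H.Colorable m := chromaticNumber_le_iff_colorable.1 hm.le
  have ht : ∀ i, ∃ t, C t = i ∧ ∀ u v, H.Adj u v → C u = i → u = t := by
    intro i
    by_cases h : ∃ t w, H.Adj t w ∧ C t = i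
    · obtain ⟨t, w, htw, rfl⟩ := h
      exact ⟨t, rfl, fun u v huv hu => C.eq_of_adj_of_adj hm.ge hcard huv htw hu⟩
    · obtain ⟨t, ht⟩ := le_chromaticNumber_iff_forall_surjective.1 hm.ge C i
      exact ⟨t, ht, fun u v huv hu => (h ⟨u, v, huv, hu⟩).elim⟩
  choose t htC ht using ht
  have hinj : Function.Injective t := Function.LeftInverse.injective htC
  refine ⟨Set.range t, by rw [Nat.card_range_of_injective hinj, Nat.card_fin], fun u v => ⟨?_, ?_⟩⟩
  · exact fun huv => ⟨huv.ne, ⟨_, (ht _ u v huv rfl).symm⟩, ⟨_, (ht _ v u huv.symm rfl).symm⟩⟩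
  · rintro ⟨hne, ⟨i, rfl⟩, ⟨j, rfl⟩⟩
    obtain ⟨u, v, huv, hu, hv⟩ :=
      C.exists_adj_of_le_chromaticNumber hm.ge (fun h : i = j => hne (congrArg t h))
    rwa [← ht i u v huv hu, ← ht j v u huv.symm hv]

end SimpleGraph

/-- If the clique partition number of `G` (the chromatic number of its complement)
is at least `n - k`, then `G` has at most `C(n,2) - C(n-k,2)` edges; moreover, in
the case of equality in both, `G` is isomorphic to `K_k ⊕ E_{n-k}`. -/
theorem edges_le_of_cliquePartition (n k : ℕ) (hk : k ≤ n) (G : SimpleGraph (Fin n)) :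
    (((n - k : ℕ) : ℕ∞) ≤ Gᶜ.chromaticNumber →
      Nat.card G.edgeSet ≤ n.choose 2 - (n - k).choose 2) ∧
    (Gᶜ.chromaticNumber = ((n - k : ℕ) : ℕ∞) →
      Nat.card G.edgeSet = n.choose 2 - (n - k).choose 2 →
      Nonempty (G ≃g cliqueJoinEmpty n k)) := by
  have hsum := natCard_edgeSet_add_natCard_edgeSet_compl G
  rw [Nat.card_fin] at hsum
  refine ⟨fun h => ?_, fun h hcard => ?_⟩
  · have := choose_two_le_natCard_edgeSet h
    omega
  · have hle := choose_two_le_natCard_edgeSet h.ge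
    obtain ⟨T, hT, hadj⟩ := exists_adj_iff_of_chromaticNumber_eq h (by omega)
    classical
    have hcardT : Fintype.card {x // x ∈ T} = Fintype.card {x : Fin n // k ≤ x} := by
      rw [← Nat.card_eq_fintype_card, hT, Fintype.card_subtype]
      have := Fin.card_filter_val_lt (n := n) (m := k)
      have := Finset.card_filter_add_card_filter_not (s := Finset.univ)
        (fun x : Fin n => (x : ℕ) < k)
      simp only [not_lt, Finset.card_univ, Fintype.card_fin] at this
      omega
    let e : {x // x ∈ T} ≃ {x : Fin n // k ≤ x} := Fintype.equivOfCardEq hcardT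
    have he : ∀ x, k ≤ (e.extendSubtype x : ℕ) ↔ x ∈ T := fun x =>
      ⟨fun hx => by_contra fun hxT => e.extendSubtype_not_mem x hxT hx, e.extendSubtype_mem x⟩
    refine ⟨⟨e.extendSubtype, fun {u v} => ?_⟩⟩
    have huv := hadj u v
    rw [compl_adj] at huv
    have hu := he u
    have hv := he v
    have hne := e.extendSubtype.injective.ne_iff (x := u) (y := v)
    have hG : G.Adj u v → u ≠ v := fun h => h.ne
    simp only [cliqueJoinEmpty, fromRel_adj]
    grind
end

section
/- For all integers a ≥ 3 and s ≥ 2, the guessing number of the subdivided complete bipartite graph satisfies gn(K*_{a,a}, s) ≤ a + 2/3. -/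
open SimpleGraph

/-- A Cauchy–Schwarz count for a family of tuples `(A, B, C, D, E)` satisfying the
functional dependencies of the 5-cycle `A - B - C - D - E - A`. -/
theorem card_sq_le_of_dependencies {P α β γ δ ε : Type*} [Fintype P] [Fintype α] [Fintype β]
    [Fintype γ] [Fintype δ] [Fintype ε] (A : P → α) (B : P → β) (C : P → γ) (D : P → δ)
    (E : P → ε)
    (hACE : ∀ p q, A p = A q → C p = C q → E p = E q → p = q)
    (hABDE : ∀ p q, A p = A q → B p = B q → D p = D q → E p = E q → p = q)
    (hBE : ∀ p q, B p = B q → E p = E q → A p = A q)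
    (hAD : ∀ p q, A p = A q → D p = D q → E p = E q) :
    Fintype.card P ^ 2 ≤ (Fintype.card β * Fintype.card ε) *
      (Fintype.card γ * (Fintype.card α * Fintype.card δ)) := by
  classical
  let F : α × ε → Finset P := fun k => Finset.univ.filter fun p => (A p, E p) = k
  have hF : ∀ k p, p ∈ F k ↔ A p = k.1 ∧ E p = k.2 := by
    intro k p; simp [F, Prod.ext_iff]
  have hsum : Fintype.card P = ∑ k, (F k).card :=
    Finset.card_eq_sum_card_fiberwise (fun p _ => Finset.mem_univ (A p, E p))
  have hγ : ∀ k, (F k).card ≤ Fintype.card γ := by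
    intro k
    refine Finset.card_le_card_of_injOn C (fun _ _ => Finset.mem_univ _) ?_
    intro p hp q hq hpq
    have hp := (hF k p).1 hp
    have hq := (hF k q).1 hq
    exact hACE p q (hp.1.trans hq.1.symm) hpq (hp.2.trans hq.2.symm)
  have hβδ : ∀ k, (F k).card ≤ ((F k).image B).card * ((F k).image D).card := by
    intro k
    rw [← Finset.card_product]
    refine Finset.card_le_card_of_injOn (fun p => (B p, D p)) ?_ ?_
    · intro p hp
      simp only [Finset.coe_product, Set.mem_prod, Finset.mem_coe]
      exact ⟨Finset.mem_image_of_mem B hp, Finset.mem_image_of_mem D hp⟩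
    · intro p hp q hq hpq
      have hp := (hF k p).1 hp
      have hq := (hF k q).1 hq
      obtain ⟨hB, hD⟩ := Prod.ext_iff.1 hpq
      exact hABDE p q (hp.1.trans hq.1.symm) hB hD (hp.2.trans hq.2.symm)
  have hb : ∑ k, ((F k).image B).card ≤ Fintype.card β * Fintype.card ε := by
    rw [← Finset.card_sigma, ← Fintype.card_prod]
    refine Finset.card_le_card_of_injOn (fun x => (x.2, x.1.2)) (fun _ _ => Finset.mem_univ _) ?_
    rintro ⟨⟨a₁, e₁⟩, b₁⟩ h₁ ⟨⟨a₂, e₂⟩, b₂⟩ h₂ h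
    simp only [Finset.coe_sigma, Set.mem_sigma_iff, Finset.mem_coe, Finset.mem_image, hF] at h₁ h₂
    obtain ⟨-, p, ⟨rfl, rfl⟩, rfl⟩ := h₁
    obtain ⟨-, q, ⟨rfl, rfl⟩, rfl⟩ := h₂
    obtain ⟨hB, hE⟩ := Prod.ext_iff.1 h
    dsimp only at hB hE
    rw [hB, hE, hBE p q hB hE]
  have hd : ∑ k, ((F k).image D).card ≤ Fintype.card α * Fintype.card δ := by
    rw [← Finset.card_sigma, ← Fintype.card_prod]
    refine Finset.card_le_card_of_injOn (fun x => (x.1.1, x.2)) (fun _ _ => Finset.mem_univ _) ?_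
    rintro ⟨⟨a₁, e₁⟩, d₁⟩ h₁ ⟨⟨a₂, e₂⟩, d₂⟩ h₂ h
    simp only [Finset.coe_sigma, Set.mem_sigma_iff, Finset.mem_coe, Finset.mem_image, hF] at h₁ h₂
    obtain ⟨-, p, ⟨rfl, rfl⟩, rfl⟩ := h₁
    obtain ⟨-, q, ⟨rfl, rfl⟩, rfl⟩ := h₂
    obtain ⟨hA, hD⟩ := Prod.ext_iff.1 h
    dsimp only at hA hD
    rw [hA, hD, hAD p q hA hD]
  calc Fintype.card P ^ 2 = (∑ k, (F k).card) ^ 2 := by rw [hsum]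
    _ ≤ (∑ k, ((F k).image B).card) * ∑ k, Fintype.card γ * ((F k).image D).card := by
        refine Finset.sum_sq_le_sum_mul_sum_of_sq_le_mul _ (fun _ _ => Nat.zero_le _)
          (fun _ _ => Nat.zero_le _) fun k _ => ?_
        calc (F k).card ^ 2 = (F k).card * (F k).card := sq _
          _ ≤ Fintype.card γ * (((F k).image B).card * ((F k).image D).card) :=
              Nat.mul_le_mul (hγ k) (hβδ k)
          _ = _ := by ring
    _ ≤ _ := by
        rw [← Finset.mul_sum]
        exact Nat.mul_le_mul hb (Nat.mul_le_mul le_rfl hd)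

/-- The number of fixed points of any strategy on `K*_{a,a}` has square at most `s ^ (2a+1)`. -/
theorem card_fixedPoints_Kstar_sq_le {a s : ℕ} (ha : 1 ≤ a)
    {f : Fin (2 * a + 1) → (Fin (2 * a + 1) → Fin s) → Fin s}
    (hf : IsGuessingStrategy (Kstar a) s f) :
    Nat.card {c : Fin (2 * a + 1) → Fin s // ∀ v, f v c = c v} ^ 2 ≤ s ^ (2 * a + 1) := by
  classical
  obtain ⟨m, rfl⟩ : ∃ m, a = m + 1 := ⟨a - 1, by omega⟩
  have key : ∀ (p q : {c : Fin (2 * (m + 1) + 1) → Fin s // ∀ v, f v c = c v}) v,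
      (∀ u, (Kstar (m + 1)).Adj v u → p.1 u = q.1 u) → p.1 v = q.1 v := by
    intro p q v h
    rw [← p.2 v, ← q.2 v]
    exact hf v _ _ h
  let A (p : {c : Fin (2 * (m + 1) + 1) → Fin s // ∀ v, f v c = c v}) : Fin s :=
    p.1 ⟨2 * (m + 1), by omega⟩
  let B (p : {c : Fin (2 * (m + 1) + 1) → Fin s // ∀ v, f v c = c v}) : Fin s :=
    p.1 ⟨0, by omega⟩
  let C (p : {c : Fin (2 * (m + 1) + 1) → Fin s // ∀ v, f v c = c v}) (i : Fin m) : Fin s :=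
    p.1 ⟨m + 2 + i, by omega⟩
  let D (p : {c : Fin (2 * (m + 1) + 1) → Fin s // ∀ v, f v c = c v}) (i : Fin m) : Fin s :=
    p.1 ⟨i + 1, by omega⟩
  let E (p : {c : Fin (2 * (m + 1) + 1) → Fin s // ∀ v, f v c = c v}) : Fin s :=
    p.1 ⟨m + 1, by omega⟩
  have hC : ∀ p q, C p = C q → ∀ u : Fin (2 * (m + 1) + 1), m + 2 ≤ (u : ℕ) →
      (u : ℕ) < 2 * (m + 1) → p.1 u = q.1 u := by
    intro p q h u h₁ h₂
    have := congrFun h ⟨u - (m + 2), by omega⟩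
    simpa only [C, Nat.add_sub_cancel' h₁] using this
  have hD : ∀ p q, D p = D q → ∀ u : Fin (2 * (m + 1) + 1), 1 ≤ (u : ℕ) →
      (u : ℕ) < m + 1 → p.1 u = q.1 u := by
    intro p q h u h₁ h₂
    have := congrFun h ⟨u - 1, by omega⟩
    simpa only [D, Nat.sub_add_cancel h₁] using this
  have hA : ∀ p q, A p = A q → ∀ u : Fin (2 * (m + 1) + 1), (u : ℕ) = 2 * (m + 1) →
      p.1 u = q.1 u := by
    rintro p q h ⟨_, _⟩ rfl
    exact h
  have hB : ∀ p q, B p = B q → ∀ u : Fin (2 * (m + 1) + 1), (u : ℕ) = 0 →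
      p.1 u = q.1 u := by
    rintro p q h ⟨_, _⟩ rfl
    exact h
  have hE : ∀ p q, E p = E q → ∀ u : Fin (2 * (m + 1) + 1), (u : ℕ) = m + 1 →
      p.1 u = q.1 u := by
    rintro p q h ⟨_, _⟩ rfl
    exact h
  have ext : ∀ p q, A p = A q → B p = B q → C p = C q → D p = D q → E p = E q → p = q := by
    intro p q h₁ h₂ h₃ h₄ h₅
    refine Subtype.ext (funext fun u => ?_)
    have hu := u.isLt
    rcases (by omega : (u : ℕ) = 2 * (m + 1) ∨ (u : ℕ) = 0 ∨
      (m + 2 ≤ (u : ℕ) ∧ (u : ℕ) < 2 * (m + 1)) ∨ (1 ≤ (u : ℕ) ∧ (u : ℕ) < m + 1) ∨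
      (u : ℕ) = m + 1) with h | h | h | h | h
    · exact hA p q h₁ u h
    · exact hB p q h₂ u h
    · exact hC p q h₃ u h.1 h.2
    · exact hD p q h₄ u h.1 h.2
    · exact hE p q h₅ u h
  have hAC : ∀ p q, A p = A q → C p = C q → B p = B q := by
    intro p q h₁ h₂
    refine key p q ⟨0, by omega⟩ fun u hu => ?_
    have hu := ((fromRel_adj _ _ _).1 hu).2
    dsimp only at hu
    rcases (by omega : (u : ℕ) = 2 * (m + 1) ∨ (m + 2 ≤ (u : ℕ) ∧ (u : ℕ) < 2 * (m + 1)))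
      with h | h
    · exact hA p q h₁ u h
    · exact hC p q h₂ u h.1 h.2
  have hCE : ∀ p q, C p = C q → E p = E q → D p = D q := by
    intro p q h₁ h₂
    refine funext fun i => key p q ⟨i + 1, by omega⟩ fun u hu => ?_
    have hu := ((fromRel_adj _ _ _).1 hu).2
    dsimp only at hu
    rcases (by omega : (u : ℕ) = m + 1 ∨ (m + 2 ≤ (u : ℕ) ∧ (u : ℕ) < 2 * (m + 1)))
      with h | h
    · exact hE p q h₂ u h
    · exact hC p q h₁ u h.1 h.2
  have hBD : ∀ p q, B p = B q → D p = D q → C p = C q := by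
    intro p q h₁ h₂
    refine funext fun i => key p q ⟨m + 2 + i, by omega⟩ fun u hu => ?_
    have hu := ((fromRel_adj _ _ _).1 hu).2
    dsimp only at hu
    rcases (by omega : (u : ℕ) = 0 ∨ (1 ≤ (u : ℕ) ∧ (u : ℕ) < m + 1)) with h | h
    · exact hB p q h₁ u h
    · exact hD p q h₂ u h.1 h.2
  have hBE : ∀ p q, B p = B q → E p = E q → A p = A q := by
    intro p q h₁ h₂
    refine key p q ⟨2 * (m + 1), by omega⟩ fun u hu => ?_
    have hu := ((fromRel_adj _ _ _).1 hu).2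
    dsimp only at hu
    rcases (by omega : (u : ℕ) = 0 ∨ (u : ℕ) = m + 1) with h | h
    · exact hB p q h₁ u h
    · exact hE p q h₂ u h
  have hAD : ∀ p q, A p = A q → D p = D q → E p = E q := by
    intro p q h₁ h₂
    refine key p q ⟨m + 1, by omega⟩ fun u hu => ?_
    have hu := ((fromRel_adj _ _ _).1 hu).2
    dsimp only at hu
    rcases (by omega : (u : ℕ) = 2 * (m + 1) ∨ (1 ≤ (u : ℕ) ∧ (u : ℕ) < m + 1)) with h | h
    · exact hA p q h₁ u h
    · exact hD p q h₂ u h.1 h.2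
  have h := card_sq_le_of_dependencies A B C D E
    (fun p q h₁ h₂ h₃ => ext p q h₁ (hAC p q h₁ h₂) h₂ (hCE p q h₂ h₃) h₃)
    (fun p q h₁ h₂ h₃ h₄ => ext p q h₁ h₂ (hBD p q h₂ h₃) h₃ h₄) hBE hAD
  rw [Nat.card_eq_fintype_card]
  refine h.trans_eq ?_
  simp only [Fintype.card_fin, Fintype.card_pi, Finset.prod_const, Finset.card_univ]
  ring

theorem maxFixedPoints_Kstar_sq_le {a : ℕ} (ha : 1 ≤ a) (s : ℕ) :
    maxFixedPoints (Kstar a) s ^ 2 ≤ s ^ (2 * a + 1) := by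
  rw [← Nat.le_sqrt']
  refine csSup_le' ?_
  rintro n ⟨f, hf, rfl⟩
  exact Nat.le_sqrt'.2 (card_fixedPoints_Kstar_sq_le ha hf)

theorem guessingNumber_Kstar_le_add_half {a s : ℕ} (ha : 1 ≤ a) (hs : 2 ≤ s) :
    guessingNumber (Kstar a) s ≤ (a : ℝ) + 1 / 2 := by
  have hs' : (1 : ℝ) < s := by exact_mod_cast hs
  unfold guessingNumber
  rcases Nat.eq_zero_or_pos (maxFixedPoints (Kstar a) s) with h0 | hpos
  · rw [h0, Nat.cast_zero, Real.logb_zero]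
    positivity
  · have hsq : ((maxFixedPoints (Kstar a) s : ℕ) : ℝ) ^ 2 ≤ (s : ℝ) ^ (2 * a + 1) := by
      exact_mod_cast maxFixedPoints_Kstar_sq_le ha s
    have hlog := Real.logb_le_logb_of_le hs' (by positivity) hsq
    rw [Real.logb_pow, Real.logb_pow, Real.logb_self_eq_one hs'] at hlog
    push_cast at hlog
    linarith

/-- For integers `a ≥ 3` and `s ≥ 2`, the guessing number of the subdivided
complete bipartite graph `K*_{a,a}` satisfies `gn(K*_{a,a}, s) ≤ a + 2/3`. -/
theorem guessingNumber_Kstar_le (a s : ℕ) (ha : 3 ≤ a) (hs : 2 ≤ s) :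
    guessingNumber (Kstar a) s ≤ (a : ℝ) + 2 / 3 := by
  linarith [guessingNumber_Kstar_le_add_half (a := a) (by omega : 1 ≤ a) hs]
end

section
/- Let a ≥ 2 and s ≥ 2 be integers and let n ≥ 2a+1. Then the saturation number satisfies sat(n, gn_s ≥ a+1) ≤ a² + 1; in particular, the graph K*_{a,a} + E_{n−2a−1} is a (gn_s ≥ a+1)-saturated graph on n vertices with a² + 1 edges. -/
open SimpleGraph

theorem bddAbove_fixedPoints {V : Type*} [Finite V] (G : SimpleGraph V) (s : ℕ) :
    BddAbove {n : ℕ | ∃ f : V → (V → Fin s) → Fin s, IsGuessingStrategy G s f ∧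
      n = Nat.card {c : V → Fin s // ∀ v, f v c = c v}} := by
  refine ⟨Nat.card (V → Fin s), ?_⟩
  rintro _ ⟨f, -, rfl⟩
  exact Nat.card_le_card_of_injective _ Subtype.val_injective

theorem le_guessingNumber {V : Type*} [Finite V] {G : SimpleGraph V} {s k : ℕ} (hs : 2 ≤ s)
    {f : V → (V → Fin s) → Fin s} (hf : IsGuessingStrategy G s f)
    (h : s ^ k ≤ Nat.card {c : V → Fin s // ∀ v, f v c = c v}) :
    (k : ℝ) ≤ guessingNumber G s := by
  have hM : s ^ k ≤ maxFixedPoints G s :=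
    h.trans (le_csSup (bddAbove_fixedPoints G s) ⟨f, hf, rfl⟩)
  have hpos : 0 < s ^ k := by positivity
  have hs' : (1 : ℝ) < s := by exact_mod_cast hs
  rw [guessingNumber, Real.le_logb_iff_rpow_le hs' (by exact_mod_cast hpos.trans_le hM),
    Real.rpow_natCast]
  exact_mod_cast hM

theorem guessingNumber_lt {V : Type*} [Finite V] {G : SimpleGraph V} {s k : ℕ} (hs : 2 ≤ s)
    (hk : 0 < k)
    (h : ∀ f : V → (V → Fin s) → Fin s, IsGuessingStrategy G s f →
      Nat.card {c : V → Fin s // ∀ v, f v c = c v} < s ^ k) :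
    guessingNumber G s < k := by
  have hM : maxFixedPoints G s < s ^ k := by
    have hne : {n : ℕ | ∃ f : V → (V → Fin s) → Fin s, IsGuessingStrategy G s f ∧
        n = Nat.card {c : V → Fin s // ∀ v, f v c = c v}}.Nonempty :=
      ⟨_, fun _ _ => ⟨0, by omega⟩, fun _ _ _ _ => rfl, rfl⟩
    obtain ⟨f, hf, he⟩ := Nat.sSup_mem hne (bddAbove_fixedPoints G s)
    rw [maxFixedPoints, he]
    exact h f hf
  have hs' : (1 : ℝ) < s := by exact_mod_cast hs
  rcases Nat.eq_zero_or_pos (maxFixedPoints G s) with h0 | h0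
  · simp [guessingNumber, h0, hk]
  · rw [guessingNumber, Real.logb_lt_iff_lt_rpow hs' (by exact_mod_cast h0), Real.rpow_natCast]
    exact_mod_cast hM

/-- If the vertices `d i` can be attached to vertices `t i` outside the range of `d` in such a way
that each `t i` together with all `d j` attached to it forms a clique, then the guessing number is
at least the number of the vertices `d i`. -/
theorem card_le_guessingNumber_of_cliques {V ι : Type*} [Finite V] [Fintype ι]
    {G : SimpleGraph V} {s : ℕ} (hs : 2 ≤ s) (d t : ι → V) (hd : Function.Injective d)
    (hdt : ∀ i j, t i ≠ d j) (hadj : ∀ i, G.Adj (d i) (t i))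
    (hcl : ∀ i j, i ≠ j → t i = t j → G.Adj (d i) (d j)) :
    (Fintype.card ι : ℝ) ≤ guessingNumber G s := by
  classical
  have : NeZero s := ⟨by omega⟩
  let f : V → (V → Fin s) → Fin s := fun v c =>
    if h : ∃ i, d i = v then
      -c (t h.choose) - ∑ j ∈ Finset.univ.filter (fun j => t j = t h.choose ∧ j ≠ h.choose), c (d j)
    else -∑ j ∈ Finset.univ.filter (fun j => t j = v), c (d j)
  have hfd : ∀ i c, f (d i) c =
      -c (t i) - ∑ j ∈ Finset.univ.filter (fun j => t j = t i ∧ j ≠ i), c (d j) := by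
    intro i c
    have h : ∃ j, d j = d i := ⟨i, rfl⟩
    have hi : h.choose = i := hd h.choose_spec
    simp only [f, dif_pos h, hi]
  have hfn : ∀ v c, (¬∃ i, d i = v) →
      f v c = -∑ j ∈ Finset.univ.filter (fun j => t j = v), c (d j) := by
    intro v c h
    simp only [f, dif_neg h]
  have hf : IsGuessingStrategy G s f := by
    intro v c₁ c₂ h
    by_cases hv : ∃ i, d i = v
    · obtain ⟨i, rfl⟩ := hv
      rw [hfd, hfd, h _ (hadj i)]
      congr 1
      refine Finset.sum_congr rfl fun j hj => h _ ?_
      simp only [Finset.mem_filter, Finset.mem_univ, true_and] at hj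
      exact hcl i j hj.2.symm hj.1.symm
    · rw [hfn _ _ hv, hfn _ _ hv]
      congr 1
      refine Finset.sum_congr rfl fun j hj => h _ ?_
      simp only [Finset.mem_filter, Finset.mem_univ, true_and] at hj
      exact hj ▸ (hadj j).symm
  refine le_guessingNumber hs hf ?_
  let e : (ι → Fin s) → V → Fin s := fun g v =>
    if h : ∃ i, d i = v then g h.choose
    else -∑ j ∈ Finset.univ.filter (fun j => t j = v), g j
  have hed : ∀ g i, e g (d i) = g i := by
    intro g i
    have h : ∃ j, d j = d i := ⟨i, rfl⟩
    have hi : h.choose = i := hd h.choose_spec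
    simp only [e, dif_pos h, hi]
  have hen : ∀ g v, (¬∃ i, d i = v) →
      e g v = -∑ j ∈ Finset.univ.filter (fun j => t j = v), g j := by
    intro g v h
    simp only [e, dif_neg h]
  have hfix : ∀ g v, f v (e g) = e g v := by
    intro g v
    by_cases hv : ∃ i, d i = v
    · obtain ⟨i, rfl⟩ := hv
      have ht : ¬∃ j, d j = t i := fun ⟨j, hj⟩ => hdt i j hj.symm
      rw [hfd, hen _ _ ht]
      simp only [hed]
      have hi : i ∈ Finset.univ.filter (fun j => t j = t i) := by simp
      have hsum := Finset.add_sum_erase _ g hi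
      have hset : Finset.univ.filter (fun j => t j = t i ∧ j ≠ i) =
          (Finset.univ.filter (fun j => t j = t i)).erase i := by
        ext j
        simp [and_comm]
      rw [hset, ← hsum]
      abel
    · rw [hfn _ _ hv, hen _ _ hv]
      simp only [hed]
  have hcard : Nat.card (ι → Fin s) = s ^ Fintype.card ι := by simp
  rw [← hcard]
  refine Nat.card_le_card_of_injective (fun g => ⟨e g, hfix g⟩) fun g g' h => ?_
  funext i
  rw [← hed g i, ← hed g' i]
  exact congrFun (congrArg Subtype.val h) (d i)

/-- The vertices `x i`, `y j` and `v` span in `H` a supergraph of `K_{a,a}` with the edge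
`x 0`–`y 0` subdivided by `v`. -/
structure IsKstarCopy {V : Type*} {a : ℕ} [NeZero a] (H : SimpleGraph V) (x y : Fin a → V)
    (v : V) : Prop where
  x_inj : Function.Injective x
  y_inj : Function.Injective y
  x_ne_y : ∀ i j, x i ≠ y j
  x_ne_v : ∀ i, x i ≠ v
  y_ne_v : ∀ i, y i ≠ v
  adj_xy : ∀ i j, ¬(i = 0 ∧ j = 0) → H.Adj (x i) (y j)
  adj_vx : H.Adj v (x 0)
  adj_vy : H.Adj v (y 0)

namespace IsKstarCopy

variable {V : Type*} {a s : ℕ} [NeZero a] {H : SimpleGraph V} {x y : Fin a → V} {v : V}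

protected theorem symm (K : IsKstarCopy H x y v) : IsKstarCopy H y x v where
  x_inj := K.y_inj
  y_inj := K.x_inj
  x_ne_y i j := (K.x_ne_y j i).symm
  x_ne_v := K.y_ne_v
  y_ne_v := K.x_ne_v
  adj_xy i j h := (K.adj_xy j i (fun h' => h h'.symm)).symm
  adj_vx := K.adj_vy
  adj_vy := K.adj_vx

/-- A matching of the `x i` and one further vertex `u` into the remaining vertices, with
collisions only between adjacent vertices, bounds the guessing number from below. -/
theorem le_guessingNumber_of_attach [Finite V] (K : IsKstarCopy H x y v) (hs : 2 ≤ s)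
    (u w : V) (t : Fin a → V) (hux : ∀ i, x i ≠ u) (htx : ∀ i j, t i ≠ x j) (htu : ∀ i, t i ≠ u)
    (hwx : ∀ i, w ≠ x i) (hadj : ∀ i, H.Adj (x i) (t i)) (huw : H.Adj u w)
    (hw : ∀ i, t i = w → H.Adj (x i) u)
    (hcl : ∀ i j, i ≠ j → t i = t j → H.Adj (x i) (x j)) :
    (a : ℝ) + 1 ≤ guessingNumber H s := by
  have h := card_le_guessingNumber_of_cliques (G := H) hs
    (fun o : Option (Fin a) => o.elim u x) (fun o => o.elim w t) ?_ ?_ ?_ ?_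
  · simpa using h
  · rintro (_ | i) (_ | j) h
    · rfl
    · exact absurd h.symm (hux j)
    · exact absurd h (hux i)
    · exact congrArg some (K.x_inj h)
  · rintro (_ | i) (_ | j)
    · exact huw.ne'
    · exact hwx j
    · exact htu i
    · exact htx i j
  · rintro (_ | i)
    · exact huw
    · exact hadj i
  · rintro (_ | i) (_ | j) hij h
    · exact absurd rfl hij
    · exact (hw j h.symm).symm
    · exact hw i h
    · exact hcl i j (fun e => hij (congrArg some e)) h

theorem le_guessingNumber_of_adj_xx [Finite V] (K : IsKstarCopy H x y v) (hs : 2 ≤ s)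
    {i j : Fin a} (h : H.Adj (x i) (x j)) : (a : ℝ) + 1 ≤ guessingNumber H s := by
  have hij : i ≠ j := fun e => h.ne (congrArg x e)
  let φ : Fin a → Fin a := fun l => if l = i then Equiv.swap i 0 j else Equiv.swap i 0 l
  have h0 : ∀ l, l ≠ i → Equiv.swap i 0 l ≠ 0 := by
    intro l hl e
    apply hl
    have := congrArg (Equiv.swap i 0) e
    simpa using this
  have hφ : ∀ l, φ l ≠ 0 := by
    intro l
    by_cases hl : l = i
    · simpa only [φ, if_pos hl] using h0 j hij.symm
    · simpa only [φ, if_neg hl] using h0 l hl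
  refine K.le_guessingNumber_of_attach hs v (y 0) (fun l => y (φ l)) K.x_ne_v
    (fun _ _ => (K.x_ne_y _ _).symm) (fun _ => K.y_ne_v _) (fun _ => (K.x_ne_y _ _).symm)
    (fun l => K.adj_xy _ _ fun e => hφ l e.2) K.adj_vy
    (fun l e => absurd (K.y_inj e) (hφ l)) ?_
  intro l m hlm e
  have e' : φ l = φ m := K.y_inj e
  by_cases hl : l = i <;> by_cases hm : m = i
  · exact absurd (hl.trans hm.symm) hlm
  · simp only [φ, if_pos hl, if_neg hm] at e'
    have := (Equiv.swap i 0).injective e'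
    subst this
    exact hl ▸ h
  · simp only [φ, if_pos hm, if_neg hl] at e'
    have := (Equiv.swap i 0).injective e'
    subst this
    exact hm ▸ h.symm
  · simp only [φ, if_neg hm, if_neg hl] at e'
    exact absurd ((Equiv.swap i 0).injective e') hlm

theorem le_guessingNumber_of_adj_zero_zero [Finite V] (K : IsKstarCopy H x y v) (hs : 2 ≤ s)
    (h : H.Adj (x 0) (y 0)) : (a : ℝ) + 1 ≤ guessingNumber H s := by
  refine K.le_guessingNumber_of_attach hs v (y 0) y K.x_ne_v
    (fun _ _ => (K.x_ne_y _ _).symm) (fun _ => K.y_ne_v _) (fun _ => (K.x_ne_y _ _).symm)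
    (fun l => ?_) K.adj_vy (fun l e => ?_) (fun l m hlm e => absurd (K.y_inj e) hlm)
  · by_cases hl : l = 0
    · exact hl ▸ h
    · exact K.adj_xy _ _ fun e => hl e.1
  · exact K.y_inj e ▸ K.adj_vx.symm

theorem swap_zero_adj (K : IsKstarCopy H x y v) {i : Fin a} (hi : i ≠ 0) (l : Fin a) :
    H.Adj (x l) (y (Equiv.swap i 0 l)) := by
  refine K.adj_xy _ _ ?_
  rintro ⟨rfl, e⟩
  simp at e
  exact hi e

theorem le_guessingNumber_of_adj_xv [Finite V] (K : IsKstarCopy H x y v) (hs : 2 ≤ s)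
    {i : Fin a} (hi : i ≠ 0) (h : H.Adj (x i) v) : (a : ℝ) + 1 ≤ guessingNumber H s := by
  refine K.le_guessingNumber_of_attach hs v (y 0) (fun l => y (Equiv.swap i 0 l)) K.x_ne_v
    (fun _ _ => (K.x_ne_y _ _).symm) (fun _ => K.y_ne_v _) (fun _ => (K.x_ne_y _ _).symm)
    (K.swap_zero_adj hi) K.adj_vy (fun l e => ?_)
    (fun l m hlm e => absurd ((Equiv.swap i 0).injective (K.y_inj e)) hlm)
  have := congrArg (Equiv.swap i 0) (K.y_inj e)
  simp only [Equiv.swap_apply_self, Equiv.swap_apply_right] at this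
  exact this ▸ h

theorem le_guessingNumber_of_adj_x_outside [Finite V] (K : IsKstarCopy H x y v) (hs : 2 ≤ s)
    {i : Fin a} {w : V} (hx : ∀ i, x i ≠ w) (hy : ∀ i, y i ≠ w) (hv : w ≠ v)
    (h : H.Adj (x i) w) : (a : ℝ) + 1 ≤ guessingNumber H s := by
  have h0 : ∀ l, l ≠ i → Equiv.swap i 0 l ≠ 0 := by
    intro l hl e
    apply hl
    have := congrArg (Equiv.swap i 0) e
    simpa using this
  refine K.le_guessingNumber_of_attach hs v (y 0)
    (fun l => if l = i then w else y (Equiv.swap i 0 l)) K.x_ne_v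
    (fun l m => ?_) (fun l => ?_) (fun _ => (K.x_ne_y _ _).symm)
    (fun l => ?_) K.adj_vy (fun l e => ?_) (fun l m hlm e => ?_)
  · split_ifs
    exacts [(hx m).symm, (K.x_ne_y _ _).symm]
  · split_ifs
    exacts [hv, K.y_ne_v _]
  · split_ifs with hl
    · exact hl ▸ h
    · exact K.adj_xy _ _ fun e => h0 l hl e.2
  · split_ifs at e with hl
    · exact absurd e.symm (hy 0)
    · exact absurd (K.y_inj e) (h0 l hl)
  · split_ifs at e with hl hm hm
    · exact absurd (hl.trans hm.symm) hlm
    · exact absurd e.symm (hy _)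
    · exact absurd e (hy _)
    · exact absurd ((Equiv.swap i 0).injective (K.y_inj e)) hlm

theorem le_guessingNumber_of_adj_outside [Finite V] (K : IsKstarCopy H x y v) (hs : 2 ≤ s)
    (ha : 2 ≤ a) {u w : V} (hxu : ∀ i, x i ≠ u) (hyu : ∀ i, y i ≠ u)
    (hxw : ∀ i, x i ≠ w) (hyw : ∀ i, y i ≠ w)
    (h : H.Adj u w) : (a : ℝ) + 1 ≤ guessingNumber H s := by
  have h1 : (⟨1, ha⟩ : Fin a) ≠ 0 := by simp [Fin.ext_iff]
  exact K.le_guessingNumber_of_attach hs u w (fun l => y (Equiv.swap ⟨1, ha⟩ 0 l)) hxu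
    (fun _ _ => (K.x_ne_y _ _).symm) (fun _ => hyu _) (fun _ => (hxw _).symm)
    (K.swap_zero_adj h1) h (fun _ e => absurd e (hyw _))
    (fun l m hlm e => absurd ((Equiv.swap _ 0).injective (K.y_inj e)) hlm)

end IsKstarCopy

theorem withIsolated_Kstar_adj {a n : ℕ} (u v : Fin n) :
    (withIsolated (Kstar a) n).Adj u v ↔
      (((u : ℕ) < a ∧ a ≤ (v : ℕ) ∧ (v : ℕ) < 2 * a ∧ ¬((u : ℕ) = 0 ∧ (v : ℕ) = a)) ∨
        ((u : ℕ) = 2 * a ∧ a ≠ 0 ∧ ((v : ℕ) = 0 ∨ (v : ℕ) = a))) ∨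
      (((v : ℕ) < a ∧ a ≤ (u : ℕ) ∧ (u : ℕ) < 2 * a ∧ ¬((v : ℕ) = 0 ∧ (u : ℕ) = a)) ∨
        ((v : ℕ) = 2 * a ∧ a ≠ 0 ∧ ((u : ℕ) = 0 ∨ (u : ℕ) = a))) := by
  simp only [withIsolated, Kstar, SimpleGraph.fromRel_adj, ne_eq, Fin.ext_iff, exists_prop]
  constructor
  · rintro ⟨h, ⟨_, _, h'⟩ | ⟨_, _, h'⟩⟩ <;> omega
  · intro h
    have h1 : (u : ℕ) < 2 * a + 1 := by omega
    have h2 : (v : ℕ) < 2 * a + 1 := by omega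
    refine ⟨by omega, Or.inl ⟨h1, h2, by omega, by omega⟩⟩

theorem guessingNumber_withIsolated_Kstar_lt {a s n : ℕ} (ha : 2 ≤ a) (hs : 2 ≤ s)
    (hn : 2 * a + 1 ≤ n) :
    guessingNumber (withIsolated (Kstar a) n) s < (a : ℝ) + 1 := by
  have : guessingNumber (withIsolated (Kstar a) n) s < ((a + 1 : ℕ) : ℝ) := by
    refine guessingNumber_lt hs (by omega) fun f hf => ?_
    have key : ∀ c c' : {c : Fin n → Fin s // ∀ v, f v c = c v}, ∀ v : Fin n,
        (∀ u, (withIsolated (Kstar a) n).Adj v u → c.1 u = c'.1 u) → c.1 v = c'.1 v := by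
      intro c c' v h
      rw [← c.2 v, ← c'.2 v]
      exact hf v _ _ h
    let r : {c : Fin n → Fin s // ∀ v, f v c = c v} → Fin (a + 1) → Fin s :=
      fun c i => c.1 ⟨i, by omega⟩
    -- the vertices outside a vertex cover are determined by it
    have hout : ∀ c c' : {c : Fin n → Fin s // ∀ v, f v c = c v},
        (∀ u : Fin n, (u : ℕ) < a → c.1 u = c'.1 u) →
        ∀ v : Fin n, a < v → (v : ℕ) ≠ 2 * a → c.1 v = c'.1 v := by
      intro c c' h v hv hv'
      refine key c c' v fun u hu => h u ?_
      rw [withIsolated_Kstar_adj] at hu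
      omega
    have hr : Function.Injective r := by
      intro c c' h
      have h1 : ∀ u : Fin n, (u : ℕ) ≤ a → c.1 u = c'.1 u := fun u hu =>
        congrFun h ⟨u, by omega⟩
      have h2 := hout c c' fun u hu => h1 u hu.le
      ext1
      funext v
      by_cases hv : (v : ℕ) ≤ a
      · exact h1 v hv
      · refine key c c' v fun u hu => h1 u ?_
        rw [withIsolated_Kstar_adj] at hu
        omega
    have hcard : Nat.card (Fin (a + 1) → Fin s) = s ^ (a + 1) := by simp
    by_contra! hge
    have hbij : Function.Bijective r := by
      rw [Nat.bijective_iff_injective_and_card]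
      refine ⟨hr, le_antisymm (Nat.card_le_card_of_injective r hr) ?_⟩
      rwa [hcard]
    have hcard' : Nat.card (Fin a → Fin s) = s ^ a := by simp
    have hle : Nat.card {c : Fin n → Fin s // ∀ v, f v c = c v} ≤ s ^ a := by
      rw [← hcard']
      refine Nat.card_le_card_of_injective
        (fun c i => c.1 ⟨a + 1 + i, by omega⟩) fun c c' h => ?_
      have h1 : ∀ u : Fin n, a < (u : ℕ) → (u : ℕ) ≤ 2 * a → c.1 u = c'.1 u := by
        intro u hu hu'
        have := congrFun h ⟨u - (a + 1), by omega⟩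
        have e : (⟨a + 1 + (u - (a + 1)), by omega⟩ : Fin n) = u := Fin.ext (by simp; omega)
        simpa only [e] using this
      have h0 : ∀ u : Fin n, (u : ℕ) = 0 → c.1 u = c'.1 u := by
        intro v hv
        refine key c c' v fun u hu => ?_
        rw [withIsolated_Kstar_adj] at hu
        exact h1 u (by omega) (by omega)
      obtain ⟨d, hd⟩ := hbij.2 fun i => if (i : ℕ) = a then r c i else r c' i
      have hda : ∀ u : Fin n, (u : ℕ) = a → d.1 u = c.1 u := by
        intro u hu
        have := congrFun hd ⟨u, by omega⟩
        rwa [if_pos hu] at this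
      have hdx : ∀ u : Fin n, (u : ℕ) < a → d.1 u = c'.1 u := by
        intro u hu
        have := congrFun hd ⟨u, by omega⟩
        rwa [if_neg hu.ne] at this
      have hdy := hout d c' hdx
      have hx : ∀ u : Fin n, (u : ℕ) < a → c.1 u = c'.1 u := by
        intro v hv
        by_cases hv0 : (v : ℕ) = 0
        · exact h0 v hv0
        rw [← hdx v hv]
        refine key c d v fun u hu => ?_
        rw [withIsolated_Kstar_adj] at hu
        by_cases hua : (u : ℕ) = a
        · exact (hda u hua).symm
        · rw [hdy u (by omega) (by omega)]
          exact h1 u (by omega) (by omega)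
      refine hr (funext fun i => ?_)
      by_cases hi : (i : ℕ) = a
      · refine key c c' _ fun u hu => ?_
        rw [withIsolated_Kstar_adj] at hu
        simp only [hi] at hu
        by_cases hua : (u : ℕ) < a
        · exact hx u hua
        · exact h1 u (by omega) (by omega)
      · exact hx _ (by have := i.2; simp only; omega)
    have : s ^ a < s ^ (a + 1) := Nat.pow_lt_pow_right (by omega) (by omega)
    omega
  simpa using this

theorem isKstarCopy_withIsolated {a n : ℕ} [NeZero a] (hn : 2 * a + 1 ≤ n) {H : SimpleGraph (Fin n)}
    (hH : withIsolated (Kstar a) n ≤ H) :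
    IsKstarCopy H (fun i : Fin a => (⟨i, by omega⟩ : Fin n))
      (fun i : Fin a => (⟨a + i, by omega⟩ : Fin n)) ⟨2 * a, by omega⟩ := by
  have ha : a ≠ 0 := NeZero.ne a
  constructor
  · intro i j h
    simpa [Fin.ext_iff] using h
  · intro i j h
    simpa [Fin.ext_iff] using h
  · intro i j h
    simp only [Fin.ext_iff] at h
    omega
  · intro i h
    simp only [Fin.ext_iff] at h
    omega
  · intro i h
    simp only [Fin.ext_iff] at h
    omega
  · intro i j h
    apply hH
    rw [withIsolated_Kstar_adj]
    simp only [Fin.ext_iff, Fin.val_zero] at h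
    simp only
    omega
  · apply hH
    rw [withIsolated_Kstar_adj]
    simp only [Fin.val_zero, true_and, true_or, and_true]
    omega
  · apply hH
    rw [withIsolated_Kstar_adj]
    simp only [Fin.val_zero, true_and]
    omega

theorem le_guessingNumber_add_edge {a s n : ℕ} (ha : 2 ≤ a) (hs : 2 ≤ s) (hn : 2 * a + 1 ≤ n)
    {H : SimpleGraph (Fin n)} (hH : withIsolated (Kstar a) n ≤ H) {u w : Fin n} (huw : u < w)
    (hnadj : ¬(withIsolated (Kstar a) n).Adj u w) (h : H.Adj u w) :
    (a : ℝ) + 1 ≤ guessingNumber H s := by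
  have : NeZero a := ⟨by omega⟩
  have K := isKstarCopy_withIsolated hn hH
  rw [withIsolated_Kstar_adj] at hnadj
  have huw' : (u : ℕ) < w := huw
  have hX : ∀ z : Fin n, (hz : (z : ℕ) < a) →
      z = (fun i : Fin a => (⟨i, by omega⟩ : Fin n)) ⟨z, hz⟩ := fun z hz => rfl
  have hY : ∀ z : Fin n, (hz : a ≤ (z : ℕ)) → (hz' : (z : ℕ) < 2 * a) →
      z = (fun i : Fin a => (⟨a + i, by omega⟩ : Fin n)) ⟨z - a, by omega⟩ :=
    fun z hz hz' => Fin.ext (by simp only; omega)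
  have hV : ∀ z : Fin n, (z : ℕ) = 2 * a → z = ⟨2 * a, by omega⟩ := fun z hz => Fin.ext hz
  have outX : ∀ z : Fin n, a ≤ (z : ℕ) →
      ∀ i : Fin a, (fun i : Fin a => (⟨i, by omega⟩ : Fin n)) i ≠ z := by
    rintro z hz i rfl
    simp only at hz
    omega
  have outY : ∀ z : Fin n, 2 * a ≤ (z : ℕ) →
      ∀ i : Fin a, (fun i : Fin a => (⟨a + i, by omega⟩ : Fin n)) i ≠ z := by
    rintro z hz i rfl
    simp only at hz
    omega
  have outV : ∀ z : Fin n, 2 * a < (z : ℕ) → z ≠ ⟨2 * a, by omega⟩ := by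
    rintro z hz rfl
    simp only at hz
    omega
  rcases lt_or_ge (u : ℕ) a with hu | hu
  · rcases lt_or_ge (w : ℕ) a with hw | hw
    · rw [hX u hu, hX w hw] at h
      exact K.le_guessingNumber_of_adj_xx hs h
    rcases lt_or_ge (w : ℕ) (2 * a) with hw' | hw'
    · have hu0 : u = (fun i : Fin a => (⟨i, by omega⟩ : Fin n)) 0 :=
        Fin.ext (by simp only [Fin.val_zero]; omega)
      have hw0 : w = (fun i : Fin a => (⟨a + i, by omega⟩ : Fin n)) 0 :=
        Fin.ext (by simp only [Fin.val_zero]; omega)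
      rw [hu0, hw0] at h
      exact K.le_guessingNumber_of_adj_zero_zero hs h
    rcases hw'.eq_or_lt with hw' | hw'
    · rw [hX u hu, hV w hw'.symm] at h
      refine K.le_guessingNumber_of_adj_xv hs ?_ h
      intro e
      have := congrArg Fin.val e
      simp only [Fin.val_zero] at this
      omega
    · rw [hX u hu] at h
      exact K.le_guessingNumber_of_adj_x_outside hs (outX w hw) (outY w hw'.le) (outV w hw') h
  rcases lt_or_ge (u : ℕ) (2 * a) with hu' | hu'
  · rw [hY u hu hu'] at h
    rcases lt_or_ge (w : ℕ) (2 * a) with hw' | hw'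
    · rw [hY w (by omega) hw'] at h
      exact K.symm.le_guessingNumber_of_adj_xx hs h
    rcases hw'.eq_or_lt with hw | hw
    · rw [hV w hw.symm] at h
      refine K.symm.le_guessingNumber_of_adj_xv hs ?_ h
      intro e
      have := congrArg Fin.val e
      simp only [Fin.val_zero] at this
      omega
    · exact K.symm.le_guessingNumber_of_adj_x_outside hs (outY w hw') (outX w (by omega))
        (outV w hw) h
  · exact K.le_guessingNumber_of_adj_outside hs ha (outX u hu) (outY u hu')
      (outX w (by omega)) (outY w (by omega)) h

theorem gnSaturated_withIsolated_Kstar {a s n : ℕ} (ha : 2 ≤ a) (hs : 2 ≤ s)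
    (hn : 2 * a + 1 ≤ n) : GNSaturated (withIsolated (Kstar a) n) s ((a : ℝ) + 1) := by
  refine ⟨guessingNumber_withIsolated_Kstar_lt ha hs hn, fun u w huw hnadj => ?_⟩
  rcases lt_or_gt_of_ne huw with h | h
  · exact le_guessingNumber_add_edge ha hs hn le_sup_left h hnadj (Or.inr (by simp [huw]))
  · exact le_guessingNumber_add_edge ha hs hn le_sup_left h (fun h' => hnadj h'.symm)
      (Or.inr (by simp [huw.symm]))

theorem card_edgeSet_withIsolated_Kstar {a n : ℕ} (ha : 0 < a) (hn : 2 * a + 1 ≤ n) :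
    Nat.card (withIsolated (Kstar a) n).edgeSet = a ^ 2 + 1 := by
  -- the edge `x 0`–`v₀` takes the place of the missing edge `x 0`–`y 0`
  let p : Option (Fin a × Fin a) → Fin n × Fin n := fun o => match o with
    | none => (⟨a, by omega⟩, ⟨2 * a, by omega⟩)
    | some (i, j) =>
      if (i : ℕ) = 0 ∧ (j : ℕ) = 0 then (⟨0, by omega⟩, ⟨2 * a, by omega⟩)
      else (⟨i, by omega⟩, ⟨a + j, by omega⟩)
  have hp : ∀ o, (withIsolated (Kstar a) n).Adj (p o).1 (p o).2 := by
    rintro (_ | ⟨i, j⟩)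
    · rw [withIsolated_Kstar_adj]
      simp only [p, and_true, true_and, or_true]
      omega
    · rw [withIsolated_Kstar_adj]
      simp only [p]
      split_ifs with h <;> simp only [true_and, true_or, and_true] <;> omega
  have hlt : ∀ o, (p o).1 < (p o).2 := by
    rintro (_ | ⟨i, j⟩)
    · simp only [p, Fin.lt_def]
      omega
    · simp only [p, Fin.lt_def]
      split_ifs with h <;> simp only <;> omega
  have hpinj : Function.Injective p := by
    rintro (_ | ⟨i, j⟩) (_ | ⟨i', j'⟩) h
    · rfl
    · simp only [p] at h
      split_ifs at h <;> simp only [Prod.mk.injEq, Fin.ext_iff] at h <;> omega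
    · simp only [p] at h
      split_ifs at h <;> simp only [Prod.mk.injEq, Fin.ext_iff] at h <;> omega
    · simp only [p] at h
      simp only [Option.some.injEq, Prod.mk.injEq, Fin.ext_iff]
      split_ifs at h <;> simp only [Prod.mk.injEq, Fin.ext_iff] at h <;> omega
  have hsurj : ∀ u w : Fin n, u < w → (withIsolated (Kstar a) n).Adj u w → ∃ o, p o = (u, w) := by
    intro u w hlt hadj
    rw [withIsolated_Kstar_adj] at hadj
    have hlt' : (u : ℕ) < w := hlt
    by_cases hw : (w : ℕ) = 2 * a
    · by_cases hu : (u : ℕ) = a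
      · exact ⟨none, by simp only [p, Prod.mk.injEq, Fin.ext_iff]; omega⟩
      · refine ⟨some (⟨0, ha⟩, ⟨0, ha⟩), ?_⟩
        simp only [p, and_self, if_true, Prod.mk.injEq, Fin.ext_iff]
        omega
    · refine ⟨some (⟨u, by omega⟩, ⟨w - a, by omega⟩), ?_⟩
      simp only [p]
      rw [if_neg (by omega)]
      simp only [Prod.mk.injEq, Fin.ext_iff, true_and]
      omega
  let e : Option (Fin a × Fin a) → (withIsolated (Kstar a) n).edgeSet :=
    fun o => ⟨s((p o).1, (p o).2), hp o⟩
  have he : Function.Bijective e := by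
    constructor
    · intro o o' h
      have h' : s((p o).1, (p o).2) = s((p o').1, (p o').2) := congrArg Subtype.val h
      rw [Sym2.eq_iff] at h'
      rcases h' with ⟨h1, h2⟩ | ⟨h1, h2⟩
      · exact hpinj (Prod.ext h1 h2)
      · have := hlt o
        rw [h1, h2] at this
        exact absurd (hlt o') this.not_gt
    · rintro ⟨z, hz⟩
      induction z with
      | _ u w =>
        have hadj : (withIsolated (Kstar a) n).Adj u w := hz
        rcases lt_or_gt_of_ne hadj.ne with h | h
        · obtain ⟨o, ho⟩ := hsurj u w h hadj
          exact ⟨o, Subtype.ext (by simp only [e, ho])⟩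
        · obtain ⟨o, ho⟩ := hsurj w u h hadj.symm
          exact ⟨o, Subtype.ext (by simp only [e, ho, Sym2.eq_swap])⟩
  rw [← Nat.card_congr (Equiv.ofBijective e he)]
  simp [sq]

/-- For `a ≥ 2`, `s ≥ 2` and `n ≥ 2a + 1`, `sat(n, gn_s ≥ a+1) ≤ a² + 1`; in
particular `K*_{a,a} + E_{n-2a-1}` is `(gn_s ≥ a+1)`-saturated with `a² + 1` edges. -/
theorem satGN_le (a s n : ℕ) (ha : 2 ≤ a) (hs : 2 ≤ s) (hn : 2 * a + 1 ≤ n) :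
    satGN n s ((a : ℝ) + 1) ≤ a ^ 2 + 1 ∧
    GNSaturated (withIsolated (Kstar a) n) s ((a : ℝ) + 1) ∧
    Nat.card (withIsolated (Kstar a) n).edgeSet = a ^ 2 + 1 := by
  have hsat := gnSaturated_withIsolated_Kstar ha hs hn
  have hcard := card_edgeSet_withIsolated_Kstar (by omega : 0 < a) hn
  exact ⟨Nat.sInf_le ⟨_, hsat, hcard.symm⟩, hsat, hcard⟩
end

section
/- Let s ≥ 2 and a ≥ 2 be integers, let b be an integer with 0 ≤ b ≤ a − 2, and let n ≥ 2a + 1. Then there exists a (gn_s ≥ a+1)-saturated graph on n vertices with exactly C(b,2) + b(n−b) + (a−b)² + 1 edges; such a graph is obtained by adding b successive dominating vertices to the graph K*_{a−b,a−b} + E_{n−b−2(a−b)−1}. -/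
open SimpleGraph

/-- One orientation of the adjacency relation of
`withDominating (withIsolated (Kstar k) m) b`, in terms of vertex labels. -/
def KstarArc (k b u v : ℕ) : Prop :=
  u < b ∨ (b ≤ u ∧ u < b + k ∧ b + k ≤ v ∧ v < b + 2 * k ∧ ¬(u = b ∧ v = b + k)) ∨
    (u = b + 2 * k ∧ (v = b ∨ v = b + k))

theorem withDominating_withIsolated_Kstar_adj {k b m : ℕ} (u v : Fin (b + m)) :
    (withDominating (withIsolated (Kstar k) m) b).Adj u v ↔
      (u : ℕ) ≠ v ∧ (KstarArc k b u v ∨ KstarArc k b v u) := by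
  have hu := u.isLt
  have hv := v.isLt
  simp only [withDominating, withIsolated, Kstar, KstarArc, SimpleGraph.fromRel_adj, ne_eq,
    Fin.ext_iff, exists_prop]
  constructor
  · rintro ⟨h, h1 | h1⟩
    · rcases h1 with h1 | h1 | ⟨h1, h2, h3, h4⟩
      · omega
      · omega
      · rcases h4 with ⟨h4, h5, h6, h7⟩ | ⟨h4, h5, h6, h7⟩ <;> omega
    · rcases h1 with h1 | h1 | ⟨h1, h2, h3, h4⟩
      · omega
      · omega
      · rcases h4 with ⟨h4, h5, h6, h7⟩ | ⟨h4, h5, h6, h7⟩ <;> omega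
  · rintro ⟨h, h1⟩
    refine ⟨h, ?_⟩
    by_cases hub : (u : ℕ) < b
    · simp [hub]
    by_cases hvb : (v : ℕ) < b
    · simp [hvb]
    refine Or.inl (Or.inr (Or.inr ⟨by omega, by omega, by omega, Or.inl ⟨?_, ?_, ?_⟩⟩)) <;> omega

section Guessing

variable {V : Type*} {G : SimpleGraph V} {s : ℕ}

theorem card_fixedPoints_le_maxFixedPoints [Finite V] {f : V → (V → Fin s) → Fin s}
    (hf : IsGuessingStrategy G s f) :
    Nat.card {c : V → Fin s // ∀ v, f v c = c v} ≤ maxFixedPoints G s := by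
  refine le_csSup ⟨Nat.card (V → Fin s), ?_⟩ ⟨f, hf, rfl⟩
  rintro _ ⟨g, -, rfl⟩
  exact Nat.card_le_card_of_injective _ Subtype.val_injective

theorem maxFixedPoints_lt [Finite V] {N : ℕ} (hN : 0 < N)
    (h : ∀ f : V → (V → Fin s) → Fin s, IsGuessingStrategy G s f →
      Nat.card {c : V → Fin s // ∀ v, f v c = c v} < N) :
    maxFixedPoints G s < N := by
  have hle : maxFixedPoints G s ≤ N - 1 := by
    refine csSup_le' ?_
    rintro _ ⟨f, hf, rfl⟩
    have := h f hf
    omega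
  omega

/-- Two fixed points agreeing on a vertex cover are equal. -/
theorem IsGuessingStrategy.eq_of_eqOn_cover {f : V → (V → Fin s) → Fin s}
    (hf : IsGuessingStrategy G s f) {S : Set V}
    (hS : ∀ u v, G.Adj u v → u ∈ S ∨ v ∈ S) {c c' : V → Fin s}
    (hc : ∀ v, f v c = c v) (hc' : ∀ v, f v c' = c' v) (h : ∀ v ∈ S, c v = c' v) :
    c = c' := by
  funext v
  by_cases hv : v ∈ S
  · exact h v hv
  · rw [← hc v, ← hc' v]
    exact hf v c c' fun u hu => h u ((hS v u hu).resolve_left hv)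

/-- If a strategy has at least `s ^ |S|` fixed points for a vertex cover `S`, then every
coloring of `S` extends to a fixed point. -/
theorem IsGuessingStrategy.exists_fixedPoint_of_le_card [Finite V]
    {f : V → (V → Fin s) → Fin s} (hf : IsGuessingStrategy G s f) {S : Set V}
    (hS : ∀ u v, G.Adj u v → u ∈ S ∨ v ∈ S)
    (hcard : s ^ Nat.card S ≤ Nat.card {c : V → Fin s // ∀ v, f v c = c v})
    (g : V → Fin s) : ∃ c : V → Fin s, (∀ v, f v c = c v) ∧ ∀ v ∈ S, c v = g v := by
  classical
  have := Fintype.ofFinite V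
  let r : {c : V → Fin s // ∀ v, f v c = c v} → (S → Fin s) := fun c v => c.1 v
  have hinj : Function.Injective r := fun c c' h =>
    Subtype.ext (hf.eq_of_eqOn_cover hS c.2 c'.2 fun v hv => congrFun h ⟨v, hv⟩)
  have hbij : Function.Bijective r := by
    rw [Fintype.bijective_iff_injective_and_card]
    refine ⟨hinj, le_antisymm (Fintype.card_le_of_injective r hinj) ?_⟩
    simpa [Nat.card_eq_fintype_card] using hcard
  obtain ⟨c, hc⟩ := hbij.2 fun v => g v
  exact ⟨c.1, c.2, fun v hv => congrFun hc ⟨v, hv⟩⟩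

/-- A partition of the vertices into `|T|` cliques yields a strategy with at least
`s ^ (|V| - |T|)` fixed points. -/
theorem pow_le_maxFixedPoints_of_clique_partition [Fintype V] [NeZero s] {ι : Type*}
    (κ : V → ι) (T : Finset ι) (hT : ∀ v, κ v ∈ T)
    (hκ : ∀ u v, u ≠ v → κ u = κ v → G.Adj u v) {e : ℕ} (he : e + T.card ≤ Fintype.card V) :
    s ^ e ≤ maxFixedPoints G s := by
  classical
  let S : (V → Fin s) → (T → Fin s) := fun c i => ∑ v with κ v = i, c v
  have hs : 0 < s := Nat.pos_of_neZero s
  obtain ⟨t, ht⟩ : ∃ t, s ^ e ≤ Fintype.card {c // S c = t} := by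
    obtain ⟨t, -, ht⟩ := Finset.exists_le_card_fiber_of_mul_le_card_of_maps_to
      (s := (Finset.univ : Finset (V → Fin s))) (t := (Finset.univ : Finset (T → Fin s)))
      (f := S) (n := s ^ e) (fun _ _ => Finset.mem_univ _) Finset.univ_nonempty (by
        simp only [Finset.card_univ, Fintype.card_fun, Fintype.card_fin, Fintype.card_coe]
        rw [← pow_add]
        exact Nat.pow_le_pow_right hs (by omega))
    exact ⟨t, by simpa [Fintype.card_subtype] using ht⟩
  let f : V → (V → Fin s) → Fin s := fun v c =>
    t ⟨κ v, hT v⟩ - ∑ u ∈ {u | κ u = κ v}.toFinset.erase v, c u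
  have hf : IsGuessingStrategy G s f := by
    intro v c₁ c₂ h
    refine congrArg (t ⟨κ v, hT v⟩ - ·) (Finset.sum_congr rfl fun u hu => h u ?_)
    simp only [Finset.mem_erase, Set.mem_toFinset, Set.mem_ofPred_eq] at hu
    exact hκ v u hu.1.symm hu.2.symm
  refine ht.trans (le_trans ?_ (card_fixedPoints_le_maxFixedPoints hf))
  rw [Nat.card_eq_fintype_card]
  refine Fintype.card_le_of_injective
    (fun c => (⟨c.1, fun v => ?_⟩ : {c : V → Fin s // ∀ v, f v c = c v})) ?_
  · have hc : ∑ u with κ u = κ v, c.1 u = t ⟨κ v, hT v⟩ := congrFun c.2 ⟨κ v, hT v⟩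
    have hmem : v ∈ {u | κ u = κ v}.toFinset := by simp
    have hsum := Finset.add_sum_erase _ c.1 hmem
    rw [sub_eq_iff_eq_add, ← hc, hsum]
    exact Finset.sum_congr (by ext; simp) fun _ _ => rfl
  · intro c c' h
    exact Subtype.ext (Subtype.mk.inj h)

theorem guessingNumber_lt_of_maxFixedPoints_lt (hs : 2 ≤ s) {e : ℕ} (he : 0 < e)
    (h : maxFixedPoints G s < s ^ e) : guessingNumber G s < e := by
  have hs1 : (1 : ℝ) < s := by exact_mod_cast hs
  unfold guessingNumber
  rcases Nat.eq_zero_or_pos (maxFixedPoints G s) with h0 | h0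
  · simpa [h0] using he
  · rw [Real.logb_lt_iff_lt_rpow hs1 (by exact_mod_cast h0), Real.rpow_natCast]
    exact_mod_cast h

theorem le_guessingNumber_of_pow_le (hs : 2 ≤ s) {e : ℕ} (h : s ^ e ≤ maxFixedPoints G s) :
    (e : ℝ) ≤ guessingNumber G s := by
  have hs1 : (1 : ℝ) < s := by exact_mod_cast hs
  have hpos : 0 < maxFixedPoints G s := lt_of_lt_of_le (by positivity) h
  unfold guessingNumber
  rw [Real.le_logb_iff_rpow_le hs1 (by exact_mod_cast hpos), Real.rpow_natCast]
  exact_mod_cast h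

end Guessing

/-- A clique partition of a graph on `Fin n` whose classes are labelled by elements of
`{0, …, n - 1}` outside a set of size `e`. -/
theorem pow_le_maxFixedPoints_of_labels {n s e : ℕ} [NeZero s] {G : SimpleGraph (Fin n)}
    (κ : ℕ → ℕ) (S : Finset ℕ) (hS : S ⊆ Finset.range n) (he : S.card = e)
    (hκS : ∀ u < n, κ u < n ∧ κ u ∉ S)
    (hκ : ∀ u v : Fin n, (u : ℕ) ≠ v → κ u = κ v → G.Adj u v) :
    s ^ e ≤ maxFixedPoints G s := by
  refine pow_le_maxFixedPoints_of_clique_partition (fun v : Fin n => κ v)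
    (Finset.range n \ S) (fun v => ?_) (fun u v huv h => hκ u v (fun h' => huv (Fin.ext h')) h) ?_
  · simpa using hκS v v.isLt
  · have h1 := Finset.card_sdiff_add_card_eq_card hS
    simp only [Finset.card_range, Fintype.card_fin] at h1 ⊢
    omega

theorem card_range_union_Ico_union_singleton {b k p q : ℕ} (hp : b ≤ p)
    (hq : q < p ∨ p + k ≤ q) (hqb : b ≤ q) :
    (Finset.range b ∪ Finset.Ico p (p + k) ∪ {q}).card = b + k + 1 := by
  rw [Finset.card_union_of_disjoint, Finset.card_union_of_disjoint]
  · simp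
  · rw [Finset.disjoint_left]
    intro x
    simp only [Finset.mem_range, Finset.mem_Ico]
    omega
  · rw [Finset.disjoint_singleton_right]
    simp only [Finset.mem_union, Finset.mem_range, Finset.mem_Ico]
    omega

theorem card_edgeSet_eq_sum_back_degree {n : ℕ} (G : SimpleGraph (Fin n))
    (R : ℕ → ℕ → Prop) [DecidableRel R] (hR : ∀ u v : Fin n, u < v → (G.Adj u v ↔ R u v)) :
    Nat.card G.edgeSet = ∑ v ∈ Finset.range n, ((Finset.range v).filter (R · v)).card := by
  classical
  rw [← Finset.card_sigma, Nat.card_eq_fintype_card, ← SimpleGraph.edgeFinset_card]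
  symm
  refine Finset.card_bij
    (fun p hp => s(⟨p.2, by simp at hp; omega⟩, ⟨p.1, by simp at hp; omega⟩)) ?_ ?_ ?_
  · rintro ⟨v, u⟩ hp
    simp only [Finset.mem_sigma, Finset.mem_range, Finset.mem_filter] at hp
    simpa using (hR ⟨u, by omega⟩ ⟨v, hp.1⟩ hp.2.1).2 hp.2.2
  · rintro ⟨v, u⟩ hp ⟨v', u'⟩ hp' h
    simp only [Finset.mem_sigma, Finset.mem_range, Finset.mem_filter] at hp hp'
    simp only [Sym2.eq_iff, Fin.mk.injEq] at h
    obtain ⟨rfl, rfl⟩ : v = v' ∧ u = u' := by omega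
    rfl
  · intro e
    induction e using Sym2.ind with
    | _ u v =>
      intro h
      rw [SimpleGraph.mem_edgeFinset, SimpleGraph.mem_edgeSet] at h
      rcases lt_or_gt_of_ne h.ne with huv | huv
      · exact ⟨⟨v, u⟩, by simpa [huv] using (hR u v huv).1 h, rfl⟩
      · exact ⟨⟨u, v⟩, by simpa [huv] using (hR v u huv).1 h.symm, Sym2.eq_swap⟩

theorem card_edgeSet_withDominating_withIsolated_Kstar {k b m : ℕ} (hk : 1 ≤ k)
    (hm : 2 * k + 1 ≤ m) :
    Nat.card (withDominating (withIsolated (Kstar k) m) b).edgeSet =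
      b.choose 2 + b * m + k ^ 2 + 1 := by
  classical
  rw [card_edgeSet_eq_sum_back_degree _ (fun u v => KstarArc k b u v ∨ KstarArc k b v u)
    fun u v huv => by
      rw [withDominating_withIsolated_Kstar_adj]
      exact and_iff_right (Fin.val_injective.ne huv.ne)]
  obtain ⟨r, rfl⟩ : ∃ r, m = k + (k + (1 + r)) := ⟨m - (2 * k + 1), by omega⟩
  simp only [Finset.sum_range_add _ _ _, Finset.sum_range_one]
  have hD : ∀ v ∈ Finset.range b, ((Finset.range v).filter
      fun u => KstarArc k b u v ∨ KstarArc k b v u).card = v := by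
    intro v hv
    rw [Finset.mem_range] at hv
    rw [Finset.filter_true_of_mem, Finset.card_range]
    intro u hu
    exact Or.inr (Or.inl hv)
  have hX : ∀ i ∈ Finset.range k, ((Finset.range (b + i)).filter
      fun u => KstarArc k b u (b + i) ∨ KstarArc k b (b + i) u).card = b := by
    intro i hi
    rw [Finset.mem_range] at hi
    convert Finset.card_range b using 2
    ext u
    simp only [Finset.mem_filter, Finset.mem_range]
    unfold KstarArc
    omega
  have hY : ∀ i ∈ Finset.range k, ((Finset.range (b + (k + i))).filter
      fun u => KstarArc k b u (b + (k + i)) ∨ KstarArc k b (b + (k + i)) u).card =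
        if i = 0 then b + k - 1 else b + k := by
    intro i hi
    rw [Finset.mem_range] at hi
    split_ifs with h
    · rw [← Finset.card_range (b + k), ← Finset.card_erase_of_mem (a := b) (by simp; omega)]
      congr 1
      ext u
      simp only [Finset.mem_filter, Finset.mem_range, Finset.mem_erase]
      unfold KstarArc
      omega
    · convert Finset.card_range (b + k) using 2
      ext u
      simp only [Finset.mem_filter, Finset.mem_range]
      unfold KstarArc
      omega
  have hV : ((Finset.range (b + (k + (k + 0)))).filter
      fun u => KstarArc k b u (b + (k + (k + 0))) ∨ KstarArc k b (b + (k + (k + 0))) u).card =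
        b + 2 := by
    have : (Finset.range (b + (k + (k + 0)))).filter
        (fun u => KstarArc k b u (b + (k + (k + 0))) ∨ KstarArc k b (b + (k + (k + 0))) u) =
        insert (b + k) (insert b (Finset.range b)) := by
      ext u
      simp only [Finset.mem_filter, Finset.mem_range, Finset.mem_insert]
      unfold KstarArc
      omega
    rw [this, Finset.card_insert_of_notMem (by simp; omega), Finset.card_insert_of_notMem (by simp),
      Finset.card_range]
  have hZ : ∀ i ∈ Finset.range r, ((Finset.range (b + (k + (k + (1 + i))))).filter
      fun u => KstarArc k b u (b + (k + (k + (1 + i)))) ∨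
        KstarArc k b (b + (k + (k + (1 + i)))) u).card = b := by
    intro i hi
    convert Finset.card_range b using 2
    ext u
    simp only [Finset.mem_filter, Finset.mem_range]
    unfold KstarArc
    omega
  rw [Finset.sum_congr rfl hD, Finset.sum_congr rfl hX, Finset.sum_congr rfl hY, hV,
    Finset.sum_congr rfl hZ, Finset.sum_range_id, ← Nat.choose_two_right]
  obtain ⟨k, rfl⟩ : ∃ j, k = j + 1 := ⟨k - 1, by omega⟩
  have hsum : ∑ i ∈ Finset.range (k + 1), (if i = 0 then b + (k + 1) - 1 else b + (k + 1)) =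
      k * (b + (k + 1)) + (b + k) := by
    simp [Finset.sum_range_succ', ← Nat.add_assoc]
  rw [hsum]
  simp only [Finset.sum_const, Finset.card_range, smul_eq_mul]
  ring

theorem maxFixedPoints_withDominating_withIsolated_Kstar_lt {k b m s : ℕ} (hk : 1 ≤ k)
    (hm : 2 * k + 1 ≤ m) (hs : 2 ≤ s) :
    maxFixedPoints (withDominating (withIsolated (Kstar k) m) b) s < s ^ (b + k + 1) := by
  set G := withDominating (withIsolated (Kstar k) m) b
  have hadj := withDominating_withIsolated_Kstar_adj (k := k) (b := b) (m := m)
  refine maxFixedPoints_lt (by positivity) fun f hf => ?_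
  by_contra! hcard
  have hcover : ∀ p, p = b ∨ p = b + k → ∀ g : Fin (b + m) → Fin s,
      ∃ c : Fin (b + m) → Fin s, (∀ v, f v c = c v) ∧
        ∀ v : Fin (b + m), ((v : ℕ) < b ∨ (p ≤ v ∧ (v : ℕ) < p + k) ∨ (v : ℕ) = b + 2 * k) →
          c v = g v := by
    intro p hp
    refine hf.exists_fixedPoint_of_le_card
      (S := {v | (v : ℕ) < b ∨ (p ≤ v ∧ (v : ℕ) < p + k) ∨ (v : ℕ) = b + 2 * k}) ?_ ?_
    · intro u v huv
      rw [hadj] at huv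
      simp only [KstarArc] at huv
      simp only [Set.mem_ofPred_eq]
      omega
    · refine le_trans (le_of_eq ?_) hcard
      congr 1
      rw [← card_range_union_Ico_union_singleton (b := b) (k := k) (p := p) (q := b + 2 * k)
        (by omega) (by omega) (by omega), Nat.card_coe_set_eq, ← Set.ncard_coe_finset,
        ← Set.ncard_image_of_injective _ Fin.val_injective]
      congr 1
      ext x
      simp only [Set.mem_image, Set.mem_ofPred_eq, Finset.coe_union, Finset.coe_range,
        Finset.coe_Ico, Finset.coe_singleton, Set.mem_union, Set.mem_Iio, Set.mem_Ico,
        Set.mem_singleton_iff]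
      constructor
      · rintro ⟨v, hv, rfl⟩
        omega
      · intro hx
        exact ⟨⟨x, by omega⟩, by simp only; omega, rfl⟩
  have key : ∀ (v : Fin (b + m)) (c c' : Fin (b + m) → Fin s), (∀ v, f v c = c v) →
      (∀ v, f v c' = c' v) → (∀ u, G.Adj v u → c u = c' u) → c v = c' v := by
    intro v c c' hc hc' h
    rw [← hc, ← hc', hf v c c' h]
  let v₀ : Fin (b + m) := ⟨b + 2 * k, by omega⟩
  let zero : Fin s := ⟨0, by omega⟩
  let one : Fin s := ⟨1, by omega⟩
  obtain ⟨c, hc, hcX⟩ := hcover b (Or.inl rfl) fun _ => zero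
  obtain ⟨c', hc', hcX'⟩ := hcover b (Or.inl rfl) fun v => if v = v₀ then one else zero
  obtain ⟨d, hd, hdY⟩ := hcover (b + k) (Or.inr rfl) fun v => if v = v₀ then one else c v
  have hne : ∀ v : Fin (b + m), (v : ℕ) ≠ b + 2 * k → v ≠ v₀ := fun v hv h => hv (by rw [h])
  have hcc' : ∀ v : Fin (b + m), (v : ℕ) < b + k → c v = c' v := by
    intro v hv
    rw [hcX v (by omega), hcX' v (by omega), if_neg (hne v (by omega))]
  have hdc : ∀ v : Fin (b + m), ((v : ℕ) < b ∨ (b + k ≤ v ∧ (v : ℕ) < b + 2 * k)) → d v = c v := by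
    intro v hv
    rw [hdY v (by omega), if_neg (hne v (by omega))]
  have hcc'Y : ∀ v : Fin (b + m), b + k < v → (v : ℕ) < b + 2 * k → c v = c' v := by
    intro v hv hv'
    refine key v c c' hc hc' fun u hu => hcc' u ?_
    rw [hadj] at hu
    simp only [KstarArc] at hu
    omega
  have hd₀ : d v₀ = c' v₀ := by
    rw [hdY v₀ (by simp [v₀]), hcX' v₀ (by simp [v₀])]
    simp
  have hdX : ∀ v : Fin (b + m), (v : ℕ) < b + k → d v = c v := by
    intro v hv
    by_cases hvb : (v : ℕ) < b
    · exact hdc v (Or.inl hvb)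
    by_cases hvx : (v : ℕ) = b
    · rw [hcc' v hv]
      refine key v d c' hd hc' fun u hu => ?_
      rw [hadj] at hu
      simp only [KstarArc] at hu
      by_cases hu₀ : u = v₀
      · rw [hu₀, hd₀]
      have hu₀' : (u : ℕ) ≠ b + 2 * k := fun h => hu₀ (Fin.ext h)
      rw [hdc u (by omega)]
      by_cases hub : (u : ℕ) < b
      · exact hcc' u (by omega)
      · exact hcc'Y u (by omega) (by omega)
    · refine key v d c hd hc fun u hu => hdc u ?_
      rw [hadj] at hu
      simp only [KstarArc] at hu
      omega
  have h01 : d v₀ = c v₀ := by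
    refine key v₀ d c hd hc fun u hu => ?_
    rw [hadj] at hu
    simp only [KstarArc, v₀] at hu
    by_cases hu' : (u : ℕ) < b + k
    · exact hdX u hu'
    · exact hdc u (by omega)
  rw [hdY v₀ (by simp [v₀]), hcX v₀ (by simp [v₀])] at h01
  simp [zero, one] at h01

set_option maxHeartbeats 1600000 in
/-- An extra edge between a vertex `u` of one side of `Kstar k` and a nonneighbor `w` lets one
replace the edge from `p` in a perfect matching by the edge `u w`, keeping the subdivision vertex
matched with the vertex `q`. -/
theorem pow_le_maxFixedPoints_of_side_edge {k b m s p q u w : ℕ} [NeZero s]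
    {G : SimpleGraph (Fin (b + m))}
    (hpq : (p = b ∧ q = b + k) ∨ (p = b + k ∧ q = b)) (hu : p ≤ u ∧ u < p + k)
    (hw : w < q ∨ q + k ≤ w ∨ w = q) (hwb : b ≤ w ∧ w < b + m ∧ u ≠ w)
    (hw₁ : w = b + 2 * k → u ≠ p) (hw₂ : w = q → u = p) (hm : 2 * k + 1 ≤ m)
    (hD : ∀ x y : Fin (b + m), (x : ℕ) < b → (x : ℕ) ≠ y → G.Adj x y)
    (hXY : ∀ x y : Fin (b + m), p ≤ (x : ℕ) → (x : ℕ) < p + k → q ≤ (y : ℕ) → (y : ℕ) < q + k →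
      ((x : ℕ) = p → (y : ℕ) ≠ q) → G.Adj x y)
    (hV : ∀ x y : Fin (b + m), (x : ℕ) = b + 2 * k → ((y : ℕ) = p ∨ (y : ℕ) = q) → G.Adj x y)
    (hE : ∀ x y : Fin (b + m), (x : ℕ) = u → (y : ℕ) = w → G.Adj x y) :
    s ^ (b + k + 1) ≤ maxFixedPoints G s := by
  obtain ⟨τ, hτ⟩ : ∃ τ : ℕ, (p ≤ w ∧ w < p + k ∧
      ((w = p ∧ τ = q + (u - p)) ∨ (w ≠ p ∧ τ = q + (w - p)))) ∨
      ((w = q ∨ w = b + 2 * k) ∧ τ = q) ∨ (b + 2 * k < w ∧ τ = w) := by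
    by_cases h1 : p ≤ w ∧ w < p + k
    · by_cases h2 : w = p
      · exact ⟨q + (u - p), by omega⟩
      · exact ⟨q + (w - p), by omega⟩
    by_cases h2 : w = q ∨ w = b + 2 * k
    · exact ⟨_, Or.inr (Or.inl ⟨h2, rfl⟩)⟩
    · exact ⟨w, by omega⟩
  obtain ⟨κ, hκ⟩ : ∃ κ : ℕ → ℕ, ∀ v, (v < b ∧ κ v = q) ∨
      (v = b + 2 * k ∧ κ v = q) ∨
      (v = u ∧ κ v = τ) ∨ (v = p ∧ v ≠ u ∧ κ v = q + (u - p)) ∨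
      (p < v ∧ v < p + k ∧ v ≠ u ∧ κ v = q + (v - p)) ∨
      (b ≤ v ∧ (v < p ∨ p + k ≤ v) ∧ v ≠ b + 2 * k ∧ κ v = v) := by
    refine ⟨fun v => if v < b ∨ v = b + 2 * k then q else if p ≤ v ∧ v < p + k then
      (if v = u then τ else if v = p then q + (u - p) else q + (v - p)) else v, fun v => ?_⟩
    dsimp only
    split_ifs <;> omega
  refine pow_le_maxFixedPoints_of_labels κ
    (Finset.range b ∪ Finset.Ico p (p + k) ∪ {b + 2 * k}) ?_
    (card_range_union_Ico_union_singleton (by omega) (by omega) (by omega)) ?_ ?_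
  · intro v
    simp only [Finset.mem_union, Finset.mem_range, Finset.mem_Ico, Finset.mem_singleton]
    omega
  · intro v hv
    simp only [Finset.mem_union, Finset.mem_range, Finset.mem_Ico, Finset.mem_singleton]
    have := hκ v
    rcases hpq with ⟨rfl, rfl⟩ | ⟨rfl, rfl⟩ <;> omega
  · intro x y hxy h
    have hx := hκ x
    have hy := hκ y
    have hxlt := x.isLt
    have hylt := y.isLt
    clear hκ
    rcases hx with hx | hx | hx | hx | hx | hx
    · exact hD x y hx.1 hxy
    all_goals rcases hy with hy | hy | hy | hy | hy | hy
    all_goals first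
      | exact (hD y x hy.1 hxy.symm).symm
      | (exfalso; omega)
      | exact hV x y (by omega) (by omega)
      | exact (hV y x (by omega) (by omega)).symm
      | exact hE x y (by omega) (by omega)
      | exact (hE y x (by omega) (by omega)).symm
      | exact hXY x y (by omega) (by omega) (by omega) (by omega) (by omega)
      | exact (hXY y x (by omega) (by omega) (by omega) (by omega) (by omega)).symm
      | skip
    all_goals rcases hτ with ⟨hτ₁, hτ₂, ⟨hτ₃, hτ₄⟩ | ⟨hτ₃, hτ₄⟩⟩ | ⟨hτ₁ | hτ₁, hτ₂⟩ | ⟨hτ₁, hτ₂⟩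
    all_goals first
      | (exfalso; omega)
      | exact hV x y (by omega) (by omega)
      | exact (hV y x (by omega) (by omega)).symm
      | exact hE x y (by omega) (by omega)
      | exact (hE y x (by omega) (by omega)).symm
      | exact hXY x y (by omega) (by omega) (by omega) (by omega) (by omega)
      | exact (hXY y x (by omega) (by omega) (by omega) (by omega) (by omega)).symm

/-- An extra edge between two vertices `u` and `w` outside both sides of `Kstar k` extends a perfect
matching between the two sides. -/
theorem pow_le_maxFixedPoints_of_outer_edge {k b m s u w : ℕ} [NeZero s]
    {G : SimpleGraph (Fin (b + m))} (hk : 2 ≤ k) (hu : b + 2 * k ≤ u ∧ u < b + m)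
    (hw : b + 2 * k ≤ w ∧ w < b + m) (huw : u ≠ w)
    (hD : ∀ x y : Fin (b + m), (x : ℕ) < b → (x : ℕ) ≠ y → G.Adj x y)
    (hXY : ∀ x y : Fin (b + m), b ≤ (x : ℕ) → (x : ℕ) < b + k → b + k ≤ (y : ℕ) →
      (y : ℕ) < b + 2 * k → ((x : ℕ) = b → (y : ℕ) ≠ b + k) → G.Adj x y)
    (hE : ∀ x y : Fin (b + m), (x : ℕ) = u → (y : ℕ) = w → G.Adj x y) :
    s ^ (b + k + 1) ≤ maxFixedPoints G s := by
  obtain ⟨κ, hκ⟩ : ∃ κ : ℕ → ℕ, ∀ v, (v < b ∧ κ v = b + k) ∨ (v = b ∧ κ v = b + k + 1) ∨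
      (v = b + 1 ∧ κ v = b + k) ∨ (b + 1 < v ∧ v < b + k ∧ κ v = k + v) ∨
      (v = u ∧ κ v = w) ∨ (b + k ≤ v ∧ v ≠ u ∧ κ v = v) := by
    refine ⟨fun v => if v < b then b + k else if v = b then b + k + 1 else if v = b + 1 then b + k
      else if v < b + k then k + v else if v = u then w else v, fun v => ?_⟩
    dsimp only
    split_ifs <;> omega
  refine pow_le_maxFixedPoints_of_labels κ
    (Finset.range b ∪ Finset.Ico b (b + k) ∪ {u}) ?_
    (card_range_union_Ico_union_singleton (by omega) (by omega) (by omega)) ?_ ?_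
  · intro v
    simp only [Finset.mem_union, Finset.mem_range, Finset.mem_Ico, Finset.mem_singleton]
    omega
  · intro v hv
    simp only [Finset.mem_union, Finset.mem_range, Finset.mem_Ico, Finset.mem_singleton]
    have := hκ v
    omega
  · intro x y hxy h
    have hx := hκ x
    have hy := hκ y
    clear hκ
    rcases hx with hx | hx | hx | hx | hx | hx
    · exact hD x y hx.1 hxy
    all_goals rcases hy with hy | hy | hy | hy | hy | hy
    all_goals first
      | exact (hD y x hy.1 hxy.symm).symm
      | (exfalso; omega)
      | exact hE x y (by omega) (by omega)
      | exact (hE y x (by omega) (by omega)).symm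
      | exact hXY x y (by omega) (by omega) (by omega) (by omega) (by omega)
      | exact (hXY y x (by omega) (by omega) (by omega) (by omega) (by omega)).symm

theorem pow_le_maxFixedPoints_add_edge {k b m s : ℕ} (hk : 2 ≤ k) (hm : 2 * k + 1 ≤ m)
    (hs : 2 ≤ s) {u w : Fin (b + m)} (huw : u ≠ w)
    (hnadj : ¬(withDominating (withIsolated (Kstar k) m) b).Adj u w) :
    s ^ (b + k + 1) ≤ maxFixedPoints
      (withDominating (withIsolated (Kstar k) m) b ⊔ SimpleGraph.fromEdgeSet {s(u, w)}) s := by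
  have : NeZero s := ⟨by omega⟩
  have huw' : (u : ℕ) ≠ w := fun h => huw (Fin.ext h)
  have hadj : ∀ x y : Fin (b + m),
      (withDominating (withIsolated (Kstar k) m) b ⊔ SimpleGraph.fromEdgeSet {s(u, w)}).Adj x y ↔
      (x : ℕ) ≠ y ∧ ((KstarArc k b x y ∨ KstarArc k b y x) ∨
        ((x : ℕ) = u ∧ (y : ℕ) = w) ∨ ((x : ℕ) = w ∧ (y : ℕ) = u)) := by
    intro x y
    simp only [SimpleGraph.sup_adj, withDominating_withIsolated_Kstar_adj,
      SimpleGraph.fromEdgeSet_adj, Set.mem_singleton_iff, Sym2.eq_iff, Fin.ext_iff, ne_eq]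
    tauto
  rw [withDominating_withIsolated_Kstar_adj] at hnadj
  generalize hG : (withDominating (withIsolated (Kstar k) m) b ⊔
    SimpleGraph.fromEdgeSet {s(u, w)}) = G at hadj ⊢
  clear hG huw
  have hu := u.isLt
  have hw := w.isLt
  generalize (u : ℕ) = u at *
  generalize (w : ℕ) = w at *
  have hwlog : ∃ p q u' w', ((p = b ∧ q = b + k) ∨ (p = b + k ∧ q = b)) ∧
      ((u' = u ∧ w' = w) ∨ (u' = w ∧ w' = u)) ∧
      ((p ≤ u' ∧ u' < p + k ∧ (w' < q ∨ q + k ≤ w' ∨ w' = q)) ∨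
        (b + 2 * k < u' ∧ b + 2 * k ≤ w')) := by
    unfold KstarArc at hnadj
    by_cases h : b + 2 * k ≤ u ∧ b + 2 * k ≤ w
    · by_cases h' : u = b + 2 * k
      · exact ⟨b, b + k, w, u, by omega⟩
      · exact ⟨b, b + k, u, w, by omega⟩
    by_cases hu' : b + 2 * k ≤ u
    · by_cases hw' : w < b + k
      · exact ⟨b, b + k, w, u, by omega⟩
      · exact ⟨b + k, b, w, u, by omega⟩
    · by_cases hu'' : u < b + k
      · exact ⟨b, b + k, u, w, by omega⟩
      · exact ⟨b + k, b, u, w, by omega⟩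
  obtain ⟨p, q, u', w', hpq, huw'', hcase⟩ := hwlog
  unfold KstarArc at hadj hnadj
  rcases hcase with ⟨hpu, hup, hw'⟩ | ⟨hu', hw'⟩
  · have hw₁ : w' = b + 2 * k → u' ≠ p := by omega
    have hw₂ : w' = q → u' = p := by omega
    have hw₃ : b ≤ w' ∧ w' < b + m ∧ u' ≠ w' := by omega
    clear hnadj
    refine pow_le_maxFixedPoints_of_side_edge (w := w') hpq ⟨hpu, hup⟩ hw' hw₃ hw₁ hw₂ hm
      (fun x y hx hxy => (hadj x y).2 ⟨hxy, Or.inl (Or.inl (Or.inl hx))⟩)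
      (fun x y h₁ h₂ h₃ h₄ h₅ => (hadj x y).2 ⟨by omega, Or.inl ?_⟩)
      (fun x y hx hy => (hadj x y).2 ⟨by omega, Or.inl (Or.inl (Or.inr (Or.inr ⟨hx, by omega⟩)))⟩)
      (fun x y hx hy => (hadj x y).2 ⟨by omega, Or.inr (by omega)⟩)
    clear hadj
    rcases hpq with ⟨rfl, rfl⟩ | ⟨rfl, rfl⟩
    · exact Or.inl (Or.inr (Or.inl ⟨h₁, h₂, h₃, by omega, by omega⟩))
    · exact Or.inr (Or.inr (Or.inl ⟨h₃, h₄, h₁, by omega, by omega⟩))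
  · exact pow_le_maxFixedPoints_of_outer_edge (u := u') (w := w') hk (by omega) (by omega)
      (by omega) (fun x y hx hxy => (hadj x y).2 ⟨hxy, Or.inl (Or.inl (Or.inl hx))⟩)
      (fun x y h₁ h₂ h₃ h₄ h₅ => (hadj x y).2
        ⟨by omega, Or.inl (Or.inl (Or.inr (Or.inl ⟨h₁, h₂, h₃, h₄, by omega⟩)))⟩)
      (fun x y hx hy => (hadj x y).2 ⟨by omega, Or.inr (by omega)⟩)

/-- For `s ≥ 2`, `a ≥ 2`, `0 ≤ b ≤ a - 2` and `n ≥ 2a + 1`, there is a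
`(gn_s ≥ a+1)`-saturated graph on `n` vertices with exactly
`C(b,2) + b(n-b) + (a-b)² + 1` edges, obtained by adding `b` dominating vertices
to `K*_{a-b,a-b} + E_{n-b-2(a-b)-1}`. -/
theorem exists_gnSaturated_spectrum (s a b n : ℕ) (hs : 2 ≤ s) (ha : 2 ≤ a)
    (hb : b ≤ a - 2) (hn : 2 * a + 1 ≤ n) :
    ∃ G : SimpleGraph (Fin n),
      GNSaturated G s ((a : ℝ) + 1) ∧
      Nat.card G.edgeSet = b.choose 2 + b * (n - b) + (a - b) ^ 2 + 1 ∧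
      Nonempty (G ≃g withDominating (withIsolated (Kstar (a - b)) (n - b)) b) := by
  obtain ⟨k, rfl⟩ : ∃ k, a = b + k := ⟨a - b, by omega⟩
  obtain ⟨m, rfl⟩ : ∃ m, n = b + m := ⟨n - b, by omega⟩
  rw [Nat.add_sub_cancel_left, Nat.add_sub_cancel_left]
  refine ⟨withDominating (withIsolated (Kstar k) m) b, ⟨?_, fun u w huw h => ?_⟩,
    card_edgeSet_withDominating_withIsolated_Kstar (by omega) (by omega), ⟨SimpleGraph.Iso.refl⟩⟩
  · exact_mod_cast guessingNumber_lt_of_maxFixedPoints_lt hs (Nat.succ_pos _)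
      (maxFixedPoints_withDominating_withIsolated_Kstar_lt (by omega) (by omega) hs)
  · exact_mod_cast le_guessingNumber_of_pow_le hs
      (pow_le_maxFixedPoints_add_edge (by omega) (by omega) hs huw h)
end
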